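/- arXiv:1810.06389 — 9 statements merged into one kernel-verified Lean document; each statement's English description precedes it below -/
import Mathlib

section
/- Let α ∈ (0,2], α' ∈ (0,1) and ν > 0. Let S be a random variable with the symmetric strictly stable distribution with characteristic exponent α (characteristic function exp(−|t|^α)), and let M be a nonnegative random variable, independent of S, with the generalized Mittag-Leffler distribution with parameters α' and ν (Laplace transform (1+s^{α'})^{−ν}). Then the product S·M^{1/α} has the generalized Linnik distribution with parameters αα' and ν; that is, E[exp(it·S·M^{1/α})] = (1+|t|^{αα'})^{−ν} for all t ∈ ℝ. -/
open MeasureTheory ProbabilityTheory Real Complex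

/-- **Theorem 2 (Korolev–Gorshenin–Zeifman).**
If `α ∈ (0,2]`, `α' ∈ (0,1)`, `ν > 0`, `S` is symmetric strictly stable with exponent `α`,
`M` has the generalized Mittag-Leffler distribution with parameters `α'` and `ν`, and
`S`, `M` are independent, then `S * M ^ (1/α)` has the generalized Linnik distribution
with parameters `α * α'` and `ν`. -/
theorem generalized_linnik_stable_mixture
    {Ω : Type*} [MeasureSpace Ω] [IsProbabilityMeasure (ℙ : Measure Ω)]
    (α α' ν : ℝ) (hα : α ∈ Set.Ioc (0 : ℝ) 2) (hα' : α' ∈ Set.Ioo (0 : ℝ) 1) (hν : 0 < ν)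
    (S M : Ω → ℝ) (hS : Measurable S) (hM : Measurable M)
    (hSchar : ∀ t : ℝ,
      ∫ ω, Complex.exp (Complex.I * t * S ω) ∂ℙ = ((Real.exp (-(|t| ^ α)) : ℝ) : ℂ))
    (hMnn : ∀ᵐ ω ∂ℙ, 0 ≤ M ω)
    (hMlap : ∀ s : ℝ, 0 ≤ s →
      ∫ ω, Real.exp (-(s * M ω)) ∂ℙ = (1 + s ^ α') ^ (-ν))
    (hindep : IndepFun S M ℙ) :
    ∀ t : ℝ,
      ∫ ω, Complex.exp (Complex.I * t * ((S ω * M ω ^ (1 / α) : ℝ) : ℂ)) ∂ℙ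
        = ((((1 + |t| ^ (α * α')) ^ (-ν) : ℝ)) : ℂ) := by
  intro t
  set g : ℝ × ℝ → ℂ := fun p ↦ Complex.exp (Complex.I * t * ((p.1 * p.2 ^ (1 / α) : ℝ) : ℂ))
    with hg
  have hgm : Measurable g := by fun_prop
  have hgn : ∀ p, ‖g p‖ = 1 := fun p ↦ by
    simp only [hg]
    rw [show Complex.I * t * ((p.1 * p.2 ^ (1 / α) : ℝ) : ℂ)
      = ((t * (p.1 * p.2 ^ (1 / α)) : ℝ) : ℂ) * Complex.I by push_cast; ring]
    exact Complex.norm_exp_ofReal_mul_I _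
  have hSprob := Measure.isProbabilityMeasure_map (μ := (ℙ : Measure Ω)) hS.aemeasurable
  have hMprob := Measure.isProbabilityMeasure_map (μ := (ℙ : Measure Ω)) hM.aemeasurable
  have hgi : Integrable g ((Measure.map S ℙ).prod (Measure.map M ℙ)) :=
    Integrable.of_bound hgm.aestronglyMeasurable 1 (.of_forall fun p ↦ (hgn p).le)
  have hlaw := (indepFun_iff_map_prod_eq_prod_map_map hS.aemeasurable hM.aemeasurable).1 hindep
  have inner_eq : ∀ m : ℝ, 0 ≤ m →
      ∫ s, g (s, m) ∂(Measure.map S ℙ) = ((Real.exp (-(|t| ^ α * m)) : ℝ) : ℂ) := by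
    intro m hm
    have hgs : Measurable fun s ↦ g (s, m) := hgm.comp measurable_prodMk_right
    rw [integral_map hS.aemeasurable hgs.aestronglyMeasurable]
    have hpow : |t * m ^ (1 / α)| ^ α = |t| ^ α * m := by
      rw [abs_mul, abs_of_nonneg (Real.rpow_nonneg hm _),
        Real.mul_rpow (abs_nonneg _) (Real.rpow_nonneg hm _), ← Real.rpow_mul hm,
        one_div_mul_cancel hα.1.ne', Real.rpow_one]
    rw [← hpow, ← hSchar]
    refine integral_congr_ae (.of_forall fun ω ↦ ?_)
    simp only [hg]
    push_cast
    ring_nf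
  calc ∫ ω, g (S ω, M ω) ∂ℙ
      = ∫ p, g p ∂((Measure.map S ℙ).prod (Measure.map M ℙ)) := by
        rw [← hlaw, integral_map (hS.prodMk hM).aemeasurable hgm.aestronglyMeasurable]
    _ = ∫ m, ∫ s, g (s, m) ∂(Measure.map S ℙ) ∂(Measure.map M ℙ) := integral_prod_symm _ hgi
    _ = ∫ ω, ∫ s, g (s, M ω) ∂(Measure.map S ℙ) ∂ℙ :=
        integral_map hM.aemeasurable hgi.integral_prod_right.aestronglyMeasurable
    _ = ∫ ω, ((Real.exp (-(|t| ^ α * M ω)) : ℝ) : ℂ) ∂ℙ := by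
        refine integral_congr_ae ?_
        filter_upwards [hMnn] with ω hω using inner_eq _ hω
    _ = _ := by
        rw [integral_complex_ofReal, hMlap _ (Real.rpow_nonneg (abs_nonneg t) α),
          ← Real.rpow_mul (abs_nonneg t)]
end

section
/- Let ν ∈ (0,1) and α ∈ (0,2]. Let L be a random variable with the Linnik distribution with parameter α (characteristic function (1+|t|^α)^{−1}), and let Z be a random variable, independent of L, with probability density p(z) = (Γ(1−ν)Γ(ν))^{−1}·(z−1)^{−ν}·z^{−1} for z ≥ 1 and p(z) = 0 for z < 1. Then the random variable L·Z^{−1/α} has the generalized Linnik distribution with parameters α and ν; that is, E[exp(it·L·Z^{−1/α})] = (1+|t|^α)^{−ν} for all t ∈ ℝ. -/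
open MeasureTheory ProbabilityTheory Real Complex

/-- The kernel `x ^ (-ν) / (x + a)` on `[0, ∞)`, whose integral is homogeneous of degree `-ν`
in `a`. -/
noncomputable def stieltjesKernel (ν a x : ℝ) : ℝ :=
  if 0 ≤ x then x ^ (-ν) / (x + a) else 0

theorem integral_stieltjesKernel (ν : ℝ) {a : ℝ} (ha : 0 < a) :
    ∫ x, stieltjesKernel ν a x = a ^ (-ν) * ∫ x, stieltjesKernel ν 1 x := by
  have hscale : ∀ x, stieltjesKernel ν a (a * x) = (a ^ (-ν) * a⁻¹) * stieltjesKernel ν 1 x := by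
    intro x
    by_cases hx : 0 ≤ x
    · have hx' : 0 ≤ a * x := mul_nonneg ha.le hx
      have h1 : x + 1 ≠ 0 := by positivity
      have h2 : a * x + a = a * (x + 1) := by ring
      simp only [stieltjesKernel, hx, hx', if_true, Real.mul_rpow ha.le hx, h2]
      field_simp
    · have hx' : ¬ 0 ≤ a * x := by
        rw [mul_nonneg_iff_of_pos_left ha]
        exact hx
      simp [stieltjesKernel, hx, hx']
  have h := Measure.integral_comp_mul_left (stieltjesKernel ν a) a
  simp only [hscale, integral_const_mul, abs_of_pos (inv_pos.mpr ha), smul_eq_mul] at h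
  have ha' : a⁻¹ ≠ 0 := inv_ne_zero ha.ne'
  apply mul_left_cancel₀ ha'
  rw [← h]
  ring

/-- The density of `Z_{ν,1}`. -/
noncomputable def mixingDensity (ν z : ℝ) : ℝ :=
  if 1 ≤ z then ((z - 1) ^ (-ν) * z⁻¹) / (Real.Gamma (1 - ν) * Real.Gamma ν) else 0

theorem measurable_mixingDensity (ν : ℝ) : Measurable (mixingDensity ν) := by
  unfold mixingDensity
  exact Measurable.ite measurableSet_Ici (by fun_prop) measurable_const

theorem mixingDensity_nonneg {ν : ℝ} (hν : ν ∈ Set.Ioo (0 : ℝ) 1) (z : ℝ) :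
    0 ≤ mixingDensity ν z := by
  unfold mixingDensity
  split_ifs with hz
  · have h1 := Real.Gamma_pos_of_pos (sub_pos.mpr hν.2)
    have h2 := Real.Gamma_pos_of_pos hν.1
    have h3 : 0 ≤ (z - 1) ^ (-ν) := Real.rpow_nonneg (sub_nonneg.mpr hz) _
    positivity
  · exact le_rfl

theorem mixingDensity_mul_inv (ν : ℝ) {s : ℝ} (hs : 0 ≤ s) (z : ℝ) :
    mixingDensity ν z * (1 + s * z⁻¹)⁻¹ =
      stieltjesKernel ν (1 + s) (z - 1) * (Real.Gamma (1 - ν) * Real.Gamma ν)⁻¹ := by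
  by_cases hz : 1 ≤ z
  · have hz0 : 0 < z := by linarith
    have h1 : z - 1 + (1 + s) = z + s := by ring
    have h2 : z + s ≠ 0 := by positivity
    have h3 : 1 + s * z⁻¹ = (z + s) * z⁻¹ := by field_simp
    simp only [mixingDensity, stieltjesKernel, hz, sub_nonneg, if_true, h1, h3, mul_inv, inv_inv,
      div_eq_mul_inv]
    field_simp
  · simp [mixingDensity, stieltjesKernel, hz]

theorem integral_mixingDensity_mul_inv {ν : ℝ} (h1 : ∫ z, mixingDensity ν z = 1)
    {s : ℝ} (hs : 0 ≤ s) :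
    ∫ z, mixingDensity ν z * (1 + s * z⁻¹)⁻¹ = (1 + s) ^ (-ν) := by
  have key : ∀ r : ℝ, 0 ≤ r → ∫ z, mixingDensity ν z * (1 + r * z⁻¹)⁻¹ =
      (1 + r) ^ (-ν) *
        ((∫ x, stieltjesKernel ν 1 x) * (Real.Gamma (1 - ν) * Real.Gamma ν)⁻¹) := by
    intro r hr
    simp only [mixingDensity_mul_inv ν hr]
    rw [integral_mul_const, integral_sub_right_eq_self (stieltjesKernel ν (1 + r)) 1,
      integral_stieltjesKernel ν (by positivity), mul_assoc]
  have h0 := key 0 le_rfl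
  simp only [zero_mul, add_zero, inv_one, mul_one, Real.one_rpow, one_mul, h1] at h0
  rw [key s hs, ← h0, mul_one]

theorem abs_mul_rpow_neg_inv_rpow {α : ℝ} (hα : 0 < α) (t : ℝ) {z : ℝ} (hz : 0 ≤ z) :
    |t * z ^ (-(1 / α))| ^ α = |t| ^ α * z⁻¹ := by
  have hz' : 0 ≤ z ^ (-(1 / α)) := Real.rpow_nonneg hz _
  rw [abs_mul, abs_of_nonneg hz', Real.mul_rpow (abs_nonneg t) hz', ← Real.rpow_mul hz,
    show -(1 / α) * α = -1 by field_simp, Real.rpow_neg_one]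

/-- The characteristic function of a product of independent variables, obtained by conditioning
on the second factor. -/
theorem integral_exp_mul_of_indepFun {Ω : Type*} [MeasurableSpace Ω] {μ : Measure Ω}
    [IsProbabilityMeasure μ] {X Y : Ω → ℝ} (hX : Measurable X) (hY : Measurable Y)
    (h : IndepFun X Y μ) {g : ℝ → ℝ} (hg : Measurable g) (t : ℝ) :
    ∫ ω, Complex.exp (Complex.I * t * ((X ω * g (Y ω) : ℝ) : ℂ)) ∂μ =
      ∫ y, ∫ ω, Complex.exp (Complex.I * ((t * g y : ℝ) : ℂ) * X ω) ∂μ ∂(μ.map Y) := by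
  have := Measure.isProbabilityMeasure_map (μ := μ) hX.aemeasurable
  have := Measure.isProbabilityMeasure_map (μ := μ) hY.aemeasurable
  let F : ℝ × ℝ → ℂ := fun p => Complex.exp (Complex.I * t * ((p.1 * g p.2 : ℝ) : ℂ))
  have hF : Measurable F := by fun_prop
  have hFi : Integrable F ((μ.map X).prod (μ.map Y)) := by
    refine Integrable.of_bound hF.aestronglyMeasurable 1 (ae_of_all _ fun p => ?_)
    simp [F, Complex.norm_exp]
  have hprod := (indepFun_iff_map_prod_eq_prod_map_map hX.aemeasurable hY.aemeasurable).mp h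
  calc ∫ ω, Complex.exp (Complex.I * t * ((X ω * g (Y ω) : ℝ) : ℂ)) ∂μ
      = ∫ p, F p ∂(μ.map fun ω => (X ω, Y ω)) :=
        (integral_map (hX.prodMk hY).aemeasurable hF.aestronglyMeasurable).symm
    _ = ∫ y, ∫ x, F (x, y) ∂(μ.map X) ∂(μ.map Y) := by rw [hprod, integral_prod_symm _ hFi]
    _ = _ := by
        refine integral_congr_ae (ae_of_all _ fun y => ?_)
        have hFy : Measurable fun x => F (x, y) := hF.comp measurable_prodMk_right
        dsimp only
        rw [integral_map hX.aemeasurable hFy.aestronglyMeasurable]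
        refine integral_congr_ae (ae_of_all _ fun ω => ?_)
        simp only [F]
        push_cast
        ring_nf

/-- **Theorem 3 (Korolev–Gorshenin–Zeifman).**
If `ν ∈ (0,1)`, `α ∈ (0,2]`, `L` has the Linnik distribution with parameter `α`, and
`Z` is independent of `L` with density `(Γ(1-ν)Γ(ν))⁻¹ (z-1)^(-ν) z⁻¹` on `[1,∞)`,
then `L * Z ^ (-1/α)` has the generalized Linnik distribution with parameters `α`, `ν`. -/
theorem generalized_linnik_as_linnik_mixture
    {Ω : Type*} [MeasureSpace Ω] [IsProbabilityMeasure (ℙ : Measure Ω)]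
    (α ν : ℝ) (hν : ν ∈ Set.Ioo (0 : ℝ) 1) (hα : α ∈ Set.Ioc (0 : ℝ) 2)
    (L Z : Ω → ℝ) (hL : Measurable L) (hZ : Measurable Z)
    (hLchar : ∀ t : ℝ,
      ∫ ω, Complex.exp (Complex.I * t * L ω) ∂ℙ = ((((1 + |t| ^ α)⁻¹ : ℝ)) : ℂ))
    (hZlaw : Measure.map Z ℙ = volume.withDensity (fun z =>
      ENNReal.ofReal (if 1 ≤ z then ((z - 1) ^ (-ν) * z⁻¹) / (Real.Gamma (1 - ν) * Real.Gamma ν)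
        else 0)))
    (hindep : IndepFun L Z ℙ) :
    ∀ t : ℝ,
      ∫ ω, Complex.exp (Complex.I * t * ((L ω * Z ω ^ (-(1 / α)) : ℝ) : ℂ)) ∂ℙ
        = ((((1 + |t| ^ α) ^ (-ν) : ℝ)) : ℂ) := by
  intro t
  have hZlaw' : Measure.map Z ℙ =
      volume.withDensity (fun z => ENNReal.ofReal (mixingDensity ν z)) := hZlaw
  have hmeas : Measurable fun z => ENNReal.ofReal (mixingDensity ν z) :=
    (measurable_mixingDensity ν).ennreal_ofReal
  have hmap (f : ℝ → ℝ) : ∫ z, f z ∂(Measure.map Z ℙ) = ∫ z, mixingDensity ν z * f z := by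
    rw [hZlaw', integral_withDensity_eq_integral_toReal_smul hmeas
      (ae_of_all _ fun _ => ENNReal.ofReal_lt_top)]
    simp only [ENNReal.toReal_ofReal (mixingDensity_nonneg hν _), smul_eq_mul]
  have hone : ∫ z, mixingDensity ν z = 1 := by
    have := Measure.isProbabilityMeasure_map (μ := (ℙ : Measure Ω)) hZ.aemeasurable
    simpa using (hmap fun _ => 1).symm
  rw [integral_exp_mul_of_indepFun hL hZ hindep (g := fun z => z ^ (-(1 / α))) (by fun_prop) t]
  simp only [hLchar]
  rw [integral_complex_ofReal, hmap,
    ← integral_mixingDensity_mul_inv hone (Real.rpow_nonneg (abs_nonneg t) α)]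
  congr 2
  funext z
  by_cases hz : 1 ≤ z
  · rw [abs_mul_rpow_neg_inv_rpow hα.1 t (by linarith)]
  · simp [mixingDensity, hz]
end

section
/- Let ν ∈ (0,1) and δ ∈ (0,1]. Let M be a nonnegative random variable with the Mittag-Leffler distribution with parameter δ (Laplace transform (1+s^δ)^{−1}), and let Z be a random variable, independent of M, with probability density p(z) = (Γ(1−ν)Γ(ν))^{−1}·(z−1)^{−ν}·z^{−1} for z ≥ 1 and 0 otherwise. Then the random variable Z^{−1/δ}·M has the generalized Mittag-Leffler distribution with parameters δ and ν; that is, E[exp(−s·Z^{−1/δ}·M)] = (1+s^δ)^{−ν} for all s ≥ 0. -/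
open MeasureTheory ProbabilityTheory Real

/-- Scaling of the Stieltjes-type integral `∫₀^∞ u ^ (-ν) / (u + c) du`. -/
theorem integral_rpow_neg_mul_inv_add (ν : ℝ) {c : ℝ} (hc : 0 < c) :
    ∫ u in Set.Ioi (0 : ℝ), u ^ (-ν) * (u + c)⁻¹ =
      c ^ (-ν) * ∫ u in Set.Ioi (0 : ℝ), u ^ (-ν) * (u + 1)⁻¹ := by
  have h := integral_comp_mul_left_Ioi (fun u : ℝ => u ^ (-ν) * (u + c)⁻¹) 0 hc
  rw [mul_zero, smul_eq_mul] at h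
  rw [eq_comm, inv_mul_eq_iff_eq_mul₀ hc.ne', ← integral_const_mul] at h
  rw [h, ← integral_const_mul]
  refine setIntegral_congr_fun measurableSet_Ioi fun u hu => ?_
  have hu' : (0 : ℝ) < u := hu
  rw [mul_rpow hc.le hu'.le]
  have : c * u + c = c * (u + 1) := by ring
  rw [this]
  field_simp

/-- Integration against the density `(z - 1) ^ (-ν) z⁻¹ / G` on `[1, ∞)` of the function
`(1 + a / z)⁻¹`. -/
theorem integral_shifted_density_mul (ν G : ℝ) {a : ℝ} (ha : 0 ≤ a) :
    ∫ z : ℝ, (if 1 ≤ z then ((z - 1) ^ (-ν) * z⁻¹) / G else 0) * (1 + a * z⁻¹)⁻¹ =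
      (1 + a) ^ (-ν) * ((∫ u in Set.Ioi (0 : ℝ), u ^ (-ν) * (u + 1)⁻¹) / G) := by
  have h1 : (fun z : ℝ => (if 1 ≤ z then ((z - 1) ^ (-ν) * z⁻¹) / G else 0) * (1 + a * z⁻¹)⁻¹) =
      (Set.Ici (1 : ℝ)).indicator fun z => ((z - 1) ^ (-ν) * (z - 1 + (1 + a))⁻¹) / G := by
    ext z
    by_cases hz : 1 ≤ z
    · have hz0 : 0 < z := by linarith
      have e : z - 1 + (1 + a) = z * (1 + a * z⁻¹) := by field_simp; ring
      rw [if_pos hz, Set.indicator_of_mem (Set.mem_Ici.2 hz), e, mul_inv]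
      ring
    · rw [if_neg hz, Set.indicator_of_notMem (by simpa using hz), zero_mul]
  rw [h1, integral_indicator measurableSet_Ici, integral_Ici_eq_integral_Ioi, integral_div,
    ← mul_div_assoc, ← integral_rpow_neg_mul_inv_add ν (by linarith : 0 < 1 + a)]
  have h2 := (measurePreserving_sub_right (volume : Measure ℝ) 1).setIntegral_preimage_emb
    (MeasurableEquiv.subRight (1 : ℝ)).measurableEmbedding
    (fun u : ℝ => u ^ (-ν) * (u + (1 + a))⁻¹) (Set.Ioi 0)
  rw [← h2]
  simp

/-- **Theorem 4 (Korolev–Gorshenin–Zeifman).**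
If `ν ∈ (0,1)`, `δ ∈ (0,1]`, `M` has the Mittag-Leffler distribution with parameter `δ`,
and `Z` is independent of `M` with density `(Γ(1-ν)Γ(ν))⁻¹ (z-1)^(-ν) z⁻¹` on `[1,∞)`,
then `Z ^ (-1/δ) * M` has the generalized Mittag-Leffler distribution with
parameters `δ` and `ν`. -/
theorem generalized_mittagLeffler_as_mittagLeffler_mixture
    {Ω : Type*} [MeasureSpace Ω] [IsProbabilityMeasure (ℙ : Measure Ω)]
    (ν δ : ℝ) (hν : ν ∈ Set.Ioo (0 : ℝ) 1) (hδ : δ ∈ Set.Ioc (0 : ℝ) 1)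
    (M Z : Ω → ℝ) (hM : Measurable M) (hZ : Measurable Z)
    (hMnn : ∀ᵐ ω ∂ℙ, 0 ≤ M ω)
    (hMlap : ∀ s : ℝ, 0 ≤ s →
      ∫ ω, Real.exp (-(s * M ω)) ∂ℙ = (1 + s ^ δ)⁻¹)
    (hZlaw : Measure.map Z ℙ = volume.withDensity (fun z =>
      ENNReal.ofReal (if 1 ≤ z then ((z - 1) ^ (-ν) * z⁻¹) / (Real.Gamma (1 - ν) * Real.Gamma ν)
        else 0)))
    (hindep : IndepFun M Z ℙ) :
    ∀ s : ℝ, 0 ≤ s →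
      ∫ ω, Real.exp (-(s * (Z ω ^ (-(1 / δ)) * M ω))) ∂ℙ = (1 + s ^ δ) ^ (-ν) := by
  intro s hs
  set G := Real.Gamma (1 - ν) * Real.Gamma ν
  have hG : 0 < G := mul_pos (Gamma_pos_of_pos (by linarith [hν.2])) (Gamma_pos_of_pos hν.1)
  set p : ℝ → ℝ := fun z => if 1 ≤ z then ((z - 1) ^ (-ν) * z⁻¹) / G else 0 with hp
  replace hZlaw : Measure.map Z ℙ = volume.withDensity (fun z => ENNReal.ofReal (p z)) := hZlaw
  have hpm : Measurable p := Measurable.ite measurableSet_Ici (by fun_prop) measurable_const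
  have hp0 : ∀ z, 0 ≤ p z := fun z => by
    simp only [hp]
    split_ifs with h
    · have h1 : 0 ≤ z - 1 := by linarith
      have h2 : 0 ≤ z := by linarith
      positivity
    · exact le_rfl
  have hint : ∀ f : ℝ → ℝ, ∫ z, f z ∂(Measure.map Z ℙ) = ∫ z, p z * f z := fun f => by
    rw [hZlaw, integral_withDensity_eq_integral_toReal_smul (by fun_prop) (by simp)]
    simp [ENNReal.toReal_ofReal (hp0 _)]
  have hZ1 : ∀ᵐ z ∂(Measure.map Z ℙ), 1 ≤ z := by
    rw [hZlaw, ae_withDensity_iff (by fun_prop)]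
    refine ae_of_all _ fun z hz => ?_
    by_contra h
    exact hz (by simp [hp, h])
  have : IsProbabilityMeasure (Measure.map Z ℙ) := Measure.isProbabilityMeasure_map hZ.aemeasurable
  have : IsProbabilityMeasure (Measure.map M ℙ) := Measure.isProbabilityMeasure_map hM.aemeasurable
  have hmass : (∫ u in Set.Ioi (0 : ℝ), u ^ (-ν) * (u + 1)⁻¹) / G = 1 := by
    have h := integral_shifted_density_mul ν G le_rfl
    rw [add_zero, one_rpow, one_mul] at h
    rw [← h, ← hint]
    simp
  have hprod := (indepFun_iff_map_prod_eq_prod_map_map hZ.aemeasurable hM.aemeasurable).1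
    hindep.symm
  let F : ℝ × ℝ → ℝ := fun x => Real.exp (-(s * (x.1 ^ (-(1 / δ)) * x.2)))
  have hF : Measurable F := by fun_prop
  have hFint : Integrable F ((Measure.map Z ℙ).prod (Measure.map M ℙ)) := by
    rw [← hprod, integrable_map_measure hF.aestronglyMeasurable (by fun_prop)]
    refine Integrable.of_bound (hF.comp (hZ.prodMk hM)).aestronglyMeasurable 1 ?_
    filter_upwards [hMnn, ae_of_ae_map hZ.aemeasurable hZ1] with ω hω hz
    have hz0 : 0 ≤ Z ω := by linarith
    simp only [F, Function.comp_apply, norm_eq_abs, abs_exp, exp_le_one_iff, neg_nonpos]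
    positivity
  calc ∫ ω, Real.exp (-(s * (Z ω ^ (-(1 / δ)) * M ω))) ∂ℙ
      = ∫ x, F x ∂(Measure.map (fun ω => (Z ω, M ω)) ℙ) :=
        (integral_map (hZ.prodMk hM).aemeasurable hF.aestronglyMeasurable).symm
    _ = ∫ z, ∫ m, F (z, m) ∂(Measure.map M ℙ) ∂(Measure.map Z ℙ) := by
        rw [hprod, integral_prod F hFint]
    _ = ∫ z, (1 + s ^ δ * z⁻¹)⁻¹ ∂(Measure.map Z ℙ) := by
        refine integral_congr_ae ?_
        filter_upwards [hZ1] with z hz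
        have hz0 : 0 ≤ z := by linarith
        have hFz : Measurable fun m => F (z, m) := hF.comp measurable_prodMk_left
        rw [integral_map hM.aemeasurable hFz.aestronglyMeasurable]
        simp only [F, ← mul_assoc]
        rw [hMlap _ (by positivity), mul_rpow hs (by positivity), ← rpow_mul hz0,
          neg_mul, one_div_mul_cancel hδ.1.ne', rpow_neg_one]
    _ = (1 + s ^ δ) ^ (-ν) := by
        rw [hint, integral_shifted_density_mul ν G (by positivity), hmass, mul_one]
end

section
/- Let δ ∈ (0,1], δ' ∈ (0,1] and ν > 0. Let S be a nonnegative random variable with the one-sided strictly stable distribution with characteristic exponent δ (Laplace transform exp(−s^δ)), and let M be a nonnegative random variable, independent of S, with the generalized Mittag-Leffler distribution with parameters δ' and ν (Laplace transform (1+s^{δ'})^{−ν}). Then the product S·M^{1/δ} has the generalized Mittag-Leffler distribution with parameters δδ' and ν; that is, E[exp(−s·S·M^{1/δ})] = (1+s^{δδ'})^{−ν} for all s ≥ 0. -/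
open MeasureTheory ProbabilityTheory Real

/-- **Theorem 5 (Korolev–Gorshenin–Zeifman).**
If `δ, δ' ∈ (0,1]`, `ν > 0`, `S` is one-sided strictly stable with exponent `δ`, `M` has the
generalized Mittag-Leffler distribution with parameters `δ'` and `ν`, and `S`, `M` are
independent, then `S * M ^ (1/δ)` has the generalized Mittag-Leffler distribution with
parameters `δ * δ'` and `ν`. -/
theorem generalized_mittagLeffler_stable_mixture
    {Ω : Type*} [MeasureSpace Ω] [IsProbabilityMeasure (ℙ : Measure Ω)]
    (δ δ' ν : ℝ) (hδ : δ ∈ Set.Ioc (0 : ℝ) 1) (hδ' : δ' ∈ Set.Ioc (0 : ℝ) 1) (hν : 0 < ν)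
    (S M : Ω → ℝ) (hS : Measurable S) (hM : Measurable M)
    (hSnn : ∀ᵐ ω ∂ℙ, 0 ≤ S ω)
    (hSlap : ∀ s : ℝ, 0 ≤ s →
      ∫ ω, Real.exp (-(s * S ω)) ∂ℙ = Real.exp (-(s ^ δ)))
    (hMnn : ∀ᵐ ω ∂ℙ, 0 ≤ M ω)
    (hMlap : ∀ s : ℝ, 0 ≤ s →
      ∫ ω, Real.exp (-(s * M ω)) ∂ℙ = (1 + s ^ δ') ^ (-ν))
    (hindep : IndepFun S M ℙ) :
    ∀ s : ℝ, 0 ≤ s →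
      ∫ ω, Real.exp (-(s * (S ω * M ω ^ (1 / δ)))) ∂ℙ = (1 + s ^ (δ * δ')) ^ (-ν) := by
  intro s hs
  obtain ⟨hδ0, -⟩ := hδ
  have hpow : Measurable fun m : ℝ => m ^ (1 / δ) := measurable_id.pow_const _
  have hf : Measurable fun p : ℝ × ℝ => Real.exp (-(s * (p.1 * p.2 ^ (1 / δ)))) :=
    ((measurable_fst.mul (hpow.comp measurable_snd)).const_mul s).neg.exp
  have hlaw : (ℙ : Measure Ω).map (fun ω => (S ω, M ω)) = (Measure.map S ℙ).prod (Measure.map M ℙ) :=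
    (indepFun_iff_map_prod_eq_prod_map_map hS.aemeasurable hM.aemeasurable).1 hindep
  have hint : Integrable (fun p : ℝ × ℝ => Real.exp (-(s * (p.1 * p.2 ^ (1 / δ)))))
      ((Measure.map S ℙ).prod (Measure.map M ℙ)) := by
    rw [← hlaw, integrable_map_measure hf.aestronglyMeasurable (hS.prodMk hM).aemeasurable]
    refine Integrable.of_bound (hf.comp (hS.prodMk hM)).aestronglyMeasurable 1 ?_
    filter_upwards [hSnn, hMnn] with ω hSω hMω
    have : 0 ≤ s * (S ω * M ω ^ (1 / δ)) := by positivity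
    simpa using this
  have : IsProbabilityMeasure ((ℙ : Measure Ω).map S) :=
    Measure.isProbabilityMeasure_map hS.aemeasurable
  have : IsProbabilityMeasure ((ℙ : Measure Ω).map M) :=
    Measure.isProbabilityMeasure_map hM.aemeasurable
  calc ∫ ω, Real.exp (-(s * (S ω * M ω ^ (1 / δ)))) ∂ℙ
      = ∫ p, Real.exp (-(s * (p.1 * p.2 ^ (1 / δ)))) ∂((Measure.map S ℙ).prod (Measure.map M ℙ)) := by
        rw [← hlaw, integral_map (hS.prodMk hM).aemeasurable hf.aestronglyMeasurable]
    _ = ∫ m, ∫ x, Real.exp (-(s * (x * m ^ (1 / δ)))) ∂(Measure.map S ℙ) ∂(Measure.map M ℙ) :=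
        integral_prod_symm _ hint
    _ = ∫ ω, ∫ x, Real.exp (-(s * (x * M ω ^ (1 / δ)))) ∂(Measure.map S ℙ) ∂ℙ :=
        integral_map hM.aemeasurable hint.integral_prod_right.aestronglyMeasurable
    _ = ∫ ω, Real.exp (-(s ^ δ * M ω)) ∂ℙ := by
        refine integral_congr_ae ?_
        filter_upwards [hMnn] with ω hMω
        have hm : 0 ≤ M ω ^ (1 / δ) := Real.rpow_nonneg hMω _
        rw [integral_map hS.aemeasurable
          (by fun_prop : Measurable fun x : ℝ =>
            Real.exp (-(s * (x * M ω ^ (1 / δ))))).aestronglyMeasurable]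
        have h := hSlap (s * M ω ^ (1 / δ)) (mul_nonneg hs hm)
        rw [Real.mul_rpow hs hm, ← Real.rpow_mul hMω, one_div_mul_cancel hδ0.ne',
          Real.rpow_one] at h
        rw [← h]
        congr 1 with ω'
        ring_nf
    _ = (1 + s ^ (δ * δ')) ^ (-ν) := by
        rw [hMlap _ (Real.rpow_nonneg hs _), ← Real.rpow_mul hs]
end

section
/- Let α ∈ (0,2] and ν > 0. Let X₁, X₂, … be real random variables and for each n let Tₙ be a measurable function of (X₁,…,Xₙ) such that for some σ > 0 and θ ∈ ℝ the statistic Tₙ is asymptotically normal: σ√n·(Tₙ − θ) converges in distribution to the standard normal law N(0,1). Let N₁, N₂, … be positive-integer-valued random variables such that each Nₙ is independent of the sequence X₁, X₂, … and Nₙ → ∞ in probability. Then σ√n·(T_{Nₙ} − θ) converges in distribution to the generalized Linnik distribution with parameters α and ν (the law with characteristic function (1+|t|^α)^{−ν}) if and only if Nₙ/n converges in distribution to (1/2)·M^{−1}, where M has the generalized Mittag-Leffler distribution with parameters α/2 and ν (Laplace transform (1+s^{α/2})^{−ν}). -/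
open MeasureTheory ProbabilityTheory Real Filter Topology

/-- Bounded convergence theorem for functions converging to zero in probability. -/
lemma tendsto_integral_zero_of_forall_eventually_measureReal_le
    {Ω E : Type*} [MeasurableSpace Ω] {P : Measure Ω} [IsProbabilityMeasure P]
    [NormedAddCommGroup E] [NormedSpace ℝ E] {D : ℕ → Ω → E} {C : ℝ}
    (hD : ∀ n, StronglyMeasurable (D n)) (hC : ∀ n ω, ‖D n ω‖ ≤ C)
    (h : ∀ ε > 0, ∀ᶠ n in atTop, P.real {ω | ε < ‖D n ω‖} ≤ ε) :
    Tendsto (fun n => ∫ ω, D n ω ∂P) atTop (𝓝 0) := by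
  have hC0 : 0 ≤ C := by
    obtain ⟨ω⟩ : Nonempty Ω := nonempty_of_isProbabilityMeasure P
    exact (norm_nonneg _).trans (hC 0 ω)
  rw [Metric.tendsto_atTop']
  intro δ hδ
  obtain ⟨n₀, hn₀⟩ := eventually_atTop.1 (h (δ / (2 * (1 + C))) (by positivity))
  refine ⟨n₀, fun n hn => ?_⟩
  set ε := δ / (2 * (1 + C)) with hε
  have hm : MeasurableSet {ω | ε < ‖D n ω‖} :=
    measurableSet_lt measurable_const (hD n).norm.measurable
  have hi : Integrable ({ω | ε < ‖D n ω‖}.indicator fun _ => C) P :=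
    (integrable_const C).indicator hm
  have hpt : ∀ ω, ‖D n ω‖ ≤ ε + {ω | ε < ‖D n ω‖}.indicator (fun _ => C) ω := by
    intro ω
    by_cases hω : ε < ‖D n ω‖
    · rw [Set.indicator_of_mem (by exact hω)]
      have : 0 < ε := by positivity
      linarith [hC n ω]
    · rw [Set.indicator_of_notMem (by exact hω)]
      linarith
  rw [dist_zero_right]
  calc ‖∫ ω, D n ω ∂P‖ ≤ ∫ ω, (ε + {ω | ε < ‖D n ω‖}.indicator (fun _ => C) ω) ∂P :=
        norm_integral_le_of_norm_le ((integrable_const ε).add hi) (ae_of_all _ hpt)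
    _ = ε + P.real {ω | ε < ‖D n ω‖} * C := by
        rw [integral_add (integrable_const ε) hi, integral_indicator_const C hm]
        simp
    _ ≤ ε + ε * C := by gcongr; exact hn₀ n hn.le
    _ = δ / 2 := by rw [hε]; field_simp
    _ < δ := by linarith

lemma norm_charFun_sub_charFun_le (μ : Measure ℝ) [IsProbabilityMeasure μ] (x y : ℝ) {r : ℝ}
    (hr : 0 ≤ r) :
    ‖charFun μ x - charFun μ y‖ ≤ |x - y| * r + 2 * μ.real {z | r < ‖z‖} := by
  have hint : ∀ t : ℝ, Integrable (fun z : ℝ => Complex.exp (t * z * Complex.I)) μ := fun t =>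
    (integrable_const (1 : ℝ)).mono' (by fun_prop) (ae_of_all _ fun z => by
      rw [← Complex.ofReal_mul, Complex.norm_exp_ofReal_mul_I])
  have hm : MeasurableSet {z : ℝ | r < ‖z‖} := measurableSet_lt measurable_const measurable_norm
  have hi : Integrable ({z : ℝ | r < ‖z‖}.indicator fun _ => (2 : ℝ)) μ :=
    (integrable_const 2).indicator hm
  have hpt : ∀ z : ℝ, ‖Complex.exp (x * z * Complex.I) - Complex.exp (y * z * Complex.I)‖ ≤
      |x - y| * r + {z : ℝ | r < ‖z‖}.indicator (fun _ => (2 : ℝ)) z := by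
    intro z
    by_cases hz : r < ‖z‖
    · rw [Set.indicator_of_mem (by exact hz)]
      have h1 := norm_sub_le (Complex.exp (x * z * Complex.I)) (Complex.exp (y * z * Complex.I))
      rw [← Complex.ofReal_mul, ← Complex.ofReal_mul, Complex.norm_exp_ofReal_mul_I,
        Complex.norm_exp_ofReal_mul_I] at h1
      rw [← Complex.ofReal_mul, ← Complex.ofReal_mul]
      have : 0 ≤ |x - y| * r := by positivity
      linarith
    · rw [Set.indicator_of_notMem (by exact hz), add_zero]
      have h1 : Complex.exp (x * z * Complex.I) - Complex.exp (y * z * Complex.I) =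
          Complex.exp (((y * z : ℝ) : ℂ) * Complex.I) *
            (Complex.exp (Complex.I * (((x - y) * z : ℝ) : ℂ)) - 1) := by
        rw [mul_sub, ← Complex.exp_add, mul_one]
        push_cast
        ring_nf
      rw [h1, norm_mul, Complex.norm_exp_ofReal_mul_I, one_mul]
      refine Real.norm_exp_I_mul_ofReal_sub_one_le.trans ?_
      rw [norm_mul, Real.norm_eq_abs]
      gcongr
      exact not_lt.1 hz
  rw [charFun_apply_real, charFun_apply_real, ← integral_sub (hint x) (hint y)]
  refine (norm_integral_le_of_norm_le ((integrable_const _).add hi) (ae_of_all _ hpt)).trans_eq ?_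
  rw [integral_add' (integrable_const _) hi, integral_indicator_const _ hm]
  simp [mul_comm]

/-- Characteristic functions of a weakly convergent sequence of probability measures converge
uniformly on compact sets. -/
lemma tendstoUniformlyOn_charFun {μ : ℕ → ProbabilityMeasure ℝ} {γ : ProbabilityMeasure ℝ}
    (h : Tendsto μ atTop (𝓝 γ)) {K : Set ℝ} (hK : IsCompact K) :
    TendstoUniformlyOn (fun n => charFun (μ n : Measure ℝ)) (charFun (γ : Measure ℝ)) atTop K := by
  have hpt := ProbabilityMeasure.tendsto_iff_tendsto_charFun.1 h
  have htight : IsTightMeasureSet (Set.range fun n => (μ n : Measure ℝ)) :=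
    isTightMeasureSet_of_tendsto_charFun (by fun_prop) hpt
  have heq : UniformEquicontinuous (fun n => charFun (μ n : Measure ℝ)) := by
    rw [Metric.uniformEquicontinuous_iff]
    intro ε hε
    have ht := tendsto_measure_norm_gt_of_isTightMeasureSet htight
    obtain ⟨r, hr, hr0⟩ := ((ht.eventually_le_const
      (ENNReal.ofReal_pos.2 (show 0 < ε / 8 by positivity))).and (eventually_gt_atTop 0)).exists
    refine ⟨ε / (2 * r), by positivity, fun x y hxy n => ?_⟩
    rw [dist_eq_norm]
    refine (norm_charFun_sub_charFun_le _ x y hr0.le).trans_lt ?_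
    have h1 : (μ n : Measure ℝ).real {z | r < ‖z‖} ≤ ε / 8 := by
      refine ENNReal.toReal_le_of_le_ofReal (by positivity) (le_trans ?_ hr)
      exact le_iSup₂ (f := fun (ν : Measure ℝ) (_ : ν ∈ Set.range fun n => (μ n : Measure ℝ)) =>
        ν {z | r < ‖z‖}) _ (Set.mem_range_self n)
    have h2 : |x - y| * r ≤ ε / 2 := by
      rw [Real.dist_eq] at hxy
      calc |x - y| * r ≤ ε / (2 * r) * r := by gcongr
        _ = ε / 2 := by field_simp
    linarith
  have := (EquicontinuousOn.tendsto_uniformOnFun_iff_pi (𝔖 := {K : Set ℝ | IsCompact K})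
    (fun K hK => hK) (Set.eq_univ_of_forall fun x => ⟨{x}, isCompact_singleton, rfl⟩)
    (fun K _ => heq.equicontinuous.equicontinuousOn K) atTop (charFun (γ : Measure ℝ))).2
    (tendsto_pi_nhds.2 hpt)
  exact UniformOnFun.tendsto_iff_tendstoUniformlyOn.1 this K hK

/-- Fubini's theorem for a function of an index and a random element independent of it. -/
lemma integral_comp_index_of_indepFun {Ω E F : Type*} [MeasurableSpace Ω] [MeasurableSpace E]
    {P : Measure Ω} [IsProbabilityMeasure P] [NormedAddCommGroup F] [NormedSpace ℝ F]
    [MeasurableSpace F] [BorelSpace F] [SecondCountableTopology F]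
    {Y : Ω → E} {N : Ω → ℕ} (hY : Measurable Y) (hN : Measurable N) (hYN : IndepFun Y N P)
    {H : ℕ → E → F} (hH : ∀ k, Measurable (H k)) {C : ℝ} (hC : ∀ k y, ‖H k y‖ ≤ C) :
    ∫ ω, H (N ω) (Y ω) ∂P = ∫ ω, ∫ ω', H (N ω) (Y ω') ∂P ∂P := by
  have hHm : Measurable (fun p : E × ℕ => H p.2 p.1) :=
    measurable_from_prod_countable_left hH
  have hmap := (indepFun_iff_map_prod_eq_prod_map_map hY.aemeasurable hN.aemeasurable).1 hYN
  have : IsProbabilityMeasure (P.map Y) := Measure.isProbabilityMeasure_map hY.aemeasurable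
  have : IsProbabilityMeasure (P.map N) := Measure.isProbabilityMeasure_map hN.aemeasurable
  have hint : Integrable (fun p : E × ℕ => H p.2 p.1) ((P.map Y).prod (P.map N)) :=
    (integrable_const C).mono' hHm.aestronglyMeasurable (ae_of_all _ fun p => hC _ _)
  calc ∫ ω, H (N ω) (Y ω) ∂P
      = ∫ p, H p.2 p.1 ∂(P.map fun ω => (Y ω, N ω)) :=
        (integral_map (f := fun p : E × ℕ => H p.2 p.1) (hY.prodMk hN).aemeasurable
          hHm.aestronglyMeasurable).symm
    _ = ∫ k, ∫ y, H k y ∂(P.map Y) ∂(P.map N) := by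
        rw [hmap, integral_prod_symm _ hint]
    _ = ∫ ω, ∫ y, H (N ω) y ∂(P.map Y) ∂P :=
        integral_map hN.aemeasurable (measurable_of_countable _).aestronglyMeasurable
    _ = ∫ ω, ∫ ω', H (N ω) (Y ω') ∂P ∂P := by
        simp_rw [integral_map hY.aemeasurable (hH _).aestronglyMeasurable]

lemma tendsto_measureReal_index_le {Ω : Type*} [MeasurableSpace Ω] {P : Measure Ω}
    {N : ℕ → Ω → ℕ} (hN : ∀ m : ℕ, Tendsto (fun n => P {ω | N n ω ≤ m}) atTop (𝓝 0)) (m : ℕ) :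
    Tendsto (fun n => P.real {ω | N n ω ≤ m}) atTop (𝓝 0) :=
  (ENNReal.tendsto_toReal ENNReal.zero_ne_top).comp (hN m)

/-- For a random index `Nₙ` that tends to infinity in probability, with `n / Nₙ` tight, replacing
the characteristic functions with index `Nₙ` by their limit does not change the limit of the
expectation. -/
lemma tendsto_integral_charFun_index_sub {Ω : Type*} [MeasurableSpace Ω] {P : Measure Ω}
    [IsProbabilityMeasure P] {μ : ℕ → ProbabilityMeasure ℝ} {γ : ProbabilityMeasure ℝ}
    (hμ : Tendsto μ atTop (𝓝 γ)) {N : ℕ → Ω → ℕ} (hNm : ∀ n, Measurable (N n))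
    (hN : ∀ m : ℕ, Tendsto (fun n => P {ω | N n ω ≤ m}) atTop (𝓝 0))
    (hV : ∀ ε > 0, ∃ R : ℝ, ∀ᶠ n : ℕ in atTop, P.real {ω | R < (n : ℝ) / N n ω} ≤ ε) (t : ℝ) :
    Tendsto (fun n : ℕ => ∫ ω, (charFun (μ (N n ω) : Measure ℝ) (t * √((n : ℝ) / N n ω)) -
      charFun (γ : Measure ℝ) (t * √((n : ℝ) / N n ω))) ∂P) atTop (𝓝 0) := by
  refine tendsto_integral_zero_of_forall_eventually_measureReal_le (C := 2) (fun n => ?_)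
    (fun n ω => ?_) fun ε hε => ?_
  · exact ((measurable_of_countable fun k : ℕ =>
      charFun (μ k : Measure ℝ) (t * √((n : ℝ) / k)) -
        charFun (γ : Measure ℝ) (t * √((n : ℝ) / k))).comp (hNm n)).stronglyMeasurable
  · refine (norm_sub_le _ _).trans ?_
    have h1 := norm_charFun_le_one (μ := (μ (N n ω) : Measure ℝ)) (t * √((n : ℝ) / N n ω))
    have h2 := norm_charFun_le_one (μ := (γ : Measure ℝ)) (t * √((n : ℝ) / N n ω))
    linarith
  · obtain ⟨R, hR⟩ := hV (ε / 2) (by positivity)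
    have hu := tendstoUniformlyOn_charFun hμ
      (isCompact_closedBall (0 : ℝ) (|t| * √R))
    rw [Metric.tendstoUniformlyOn_iff] at hu
    obtain ⟨K, hK⟩ := eventually_atTop.1 (hu ε hε)
    filter_upwards [hR, (tendsto_measureReal_index_le hN K).eventually_le_const
      (show 0 < ε / 2 by positivity)] with n hn1 hn2
    have hsub : {ω | ε < ‖charFun (μ (N n ω) : Measure ℝ) (t * √((n : ℝ) / N n ω)) -
        charFun (γ : Measure ℝ) (t * √((n : ℝ) / N n ω))‖} ⊆
        {ω | R < (n : ℝ) / N n ω} ∪ {ω | N n ω ≤ K} := by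
      intro ω hω
      by_contra hcon
      simp only [Set.mem_union, Set.mem_ofPred_eq, not_or, not_lt, not_le] at hcon hω
      have h1 := hK (N n ω) hcon.2.le (t * √((n : ℝ) / N n ω)) (by
        rw [mem_closedBall_zero_iff, norm_mul, Real.norm_eq_abs, Real.norm_eq_abs,
          abs_of_nonneg (Real.sqrt_nonneg _)]
        gcongr
        exact hcon.1)
      rw [dist_comm, dist_eq_norm] at h1
      linarith
    calc _ ≤ P.real ({ω | R < (n : ℝ) / N n ω} ∪ {ω | N n ω ≤ K}) := measureReal_mono hsub
      _ ≤ P.real {ω | R < (n : ℝ) / N n ω} + P.real {ω | N n ω ≤ K} := measureReal_union_le _ _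
      _ ≤ ε := by linarith

/-- The bounded continuous function `x ↦ min |x| 1`. -/
noncomputable def minAbsOne : BoundedContinuousFunction ℝ ℝ :=
  BoundedContinuousFunction.ofNormedAddCommGroup (fun x => min |x| 1) (by fun_prop) 1 fun x => by
    rw [Real.norm_eq_abs, abs_of_nonneg (by positivity)]
    exact min_le_right _ _

lemma minAbsOne_apply (x : ℝ) : minAbsOne x = min |x| 1 := rfl

lemma minAbsOne_nonneg (x : ℝ) : 0 ≤ minAbsOne x := by
  rw [minAbsOne_apply]
  positivity

lemma minAbsOne_le_one (x : ℝ) : minAbsOne x ≤ 1 := min_le_right _ _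

lemma norm_minAbsOne_le_one (x : ℝ) : ‖minAbsOne x‖ ≤ 1 := by
  rw [Real.norm_eq_abs, abs_of_nonneg (minAbsOne_nonneg x)]
  exact minAbsOne_le_one x

lemma integral_minAbsOne_gaussianReal_pos :
    0 < ∫ x, minAbsOne x ∂(gaussianReal 0 1) := by
  rw [integral_pos_iff_support_of_nonneg minAbsOne_nonneg (minAbsOne.integrable _)]
  have hs : Function.support minAbsOne = {0}ᶜ := by
    ext x
    simp only [Function.mem_support, minAbsOne_apply, Set.mem_compl_iff, Set.mem_singleton_iff,
      ne_eq, not_iff_not]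
    constructor
    · intro h
      rcases min_choice |x| 1 with h' | h' <;> rw [h'] at h
      · exact abs_eq_zero.1 h
      · norm_num at h
    · rintro rfl
      simp
  have : NullSingletonClass (gaussianReal 0 1) := nullSingletonClass_gaussianReal one_ne_zero
  rw [hs, prob_compl_eq_one_sub (measurableSet_singleton 0), measure_singleton]
  simp

lemma tendsto_integral_minAbsOne_div (μ : Measure ℝ) [IsProbabilityMeasure μ] :
    Tendsto (fun r : ℝ => ∫ x, minAbsOne (x / r) ∂μ) atTop (𝓝 0) := by
  have h := tendsto_integral_filter_of_dominated_convergence (μ := μ) (l := (atTop : Filter ℝ))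
    (F := fun r x => minAbsOne (x / r)) (f := fun _ => (0 : ℝ)) (fun _ => 1)
    (Eventually.of_forall fun r => (by fun_prop : Measurable _).aestronglyMeasurable)
    (Eventually.of_forall fun r => ae_of_all _ fun x => norm_minAbsOne_le_one _)
    (integrable_const _) (ae_of_all _ fun x => by
      have h1 : Tendsto (fun r : ℝ => x / r) atTop (𝓝 0) := tendsto_const_nhds.div_atTop tendsto_id
      have h2 := (minAbsOne.continuous.tendsto 0).comp h1
      rwa [show minAbsOne 0 = 0 by simp [minAbsOne_apply]] at h2)
  simpa using h

/-- If the randomly indexed and rescaled sequence converges in distribution and the sequence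
itself is asymptotically normal, then the random scales are tight. -/
lemma exists_eventually_measureReal_lt_div_index_le_of_tendsto
    {Ω E : Type*} [MeasurableSpace Ω] [MeasurableSpace E] {P : Measure Ω} [IsProbabilityMeasure P]
    {Y : Ω → E} (hY : Measurable Y) {Z : ℕ → E → ℝ} (hZm : ∀ k, Measurable (Z k))
    (hZ : ∀ f : BoundedContinuousFunction ℝ ℝ, Tendsto (fun k => ∫ ω, f (Z k (Y ω)) ∂P) atTop
      (𝓝 (∫ x, f x ∂(gaussianReal 0 1))))
    {N : ℕ → Ω → ℕ} (hNm : ∀ n, Measurable (N n)) (hYN : ∀ n, IndepFun Y (N n) P)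
    (hN : ∀ m : ℕ, Tendsto (fun n => P {ω | N n ω ≤ m}) atTop (𝓝 0))
    {μ : Measure ℝ} [IsProbabilityMeasure μ]
    (hS : ∀ f : BoundedContinuousFunction ℝ ℝ,
      Tendsto (fun n : ℕ => ∫ ω, f (√((n : ℝ) / N n ω) * Z (N n ω) (Y ω)) ∂P) atTop
        (𝓝 (∫ x, f x ∂μ))) {ε : ℝ} (hε : 0 < ε) :
    ∃ R : ℝ, ∀ᶠ n : ℕ in atTop, P.real {ω | R < (n : ℝ) / N n ω} ≤ ε := by
  set a := ∫ x, minAbsOne x ∂(gaussianReal 0 1) with ha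
  have ha0 : 0 < a := integral_minAbsOne_gaussianReal_pos
  have ha1 : a ≤ 1 := by
    refine (integral_mono (minAbsOne.integrable _) (integrable_const 1)
      minAbsOne_le_one).trans_eq ?_
    simp
  obtain ⟨K, hK⟩ := eventually_atTop.1
    ((hZ minAbsOne).eventually_const_le (show a / 2 < a by linarith))
  obtain ⟨r, hr, hr0⟩ := (((tendsto_integral_minAbsOne_div μ).eventually_lt_const
    (show 0 < a / 2 * ε / 2 by positivity)).and (eventually_gt_atTop 0)).exists
  have hSr := hS (minAbsOne.compContinuous ⟨fun x => x / r, by fun_prop⟩)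
  simp only [BoundedContinuousFunction.compContinuous_apply, ContinuousMap.coe_mk] at hSr
  refine ⟨r ^ 2, ?_⟩
  filter_upwards [hSr.eventually_lt_const hr, (tendsto_measureReal_index_le hN K).eventually_lt_const
    (show 0 < a / 2 * ε / 2 by positivity)] with n hn1 hn2
  have hfub := integral_comp_index_of_indepFun (F := ℝ) hY (hNm n) (hYN n)
    (H := fun k y => minAbsOne (√((n : ℝ) / k) * Z k y / r)) (C := 1)
    (fun k => minAbsOne.continuous.measurable.comp (((hZm k).const_mul _).div_const _))
    (fun k y => norm_minAbsOne_le_one _)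
  have hA : MeasurableSet {ω | r ^ 2 < (n : ℝ) / N n ω} :=
    (hNm n) (MeasurableSet.of_discrete (s := {k : ℕ | r ^ 2 < (n : ℝ) / k}))
  have hB : MeasurableSet {ω | N n ω ≤ K} := (hNm n) (MeasurableSet.of_discrete (s := Set.Iic K))
  set g : ℕ → ℝ := fun k => ∫ ω', minAbsOne (√((n : ℝ) / k) * Z k (Y ω') / r) ∂P with hg
  have hg0 : ∀ k, 0 ≤ g k := fun k => integral_nonneg fun _ => minAbsOne_nonneg _
  have hgi : Integrable (fun ω => g (N n ω)) P := by
    refine (integrable_const (1 : ℝ)).mono'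
      ((measurable_of_countable g).comp (hNm n)).aestronglyMeasurable (ae_of_all _ fun ω => ?_)
    refine (norm_integral_le_of_norm_le_const (ae_of_all _ fun ω' =>
      norm_minAbsOne_le_one _)).trans_eq ?_
    simp
  have hpt : ∀ ω, {ω | r ^ 2 < (n : ℝ) / N n ω}.indicator (fun _ => a / 2) ω ≤
      g (N n ω) + {ω | N n ω ≤ K}.indicator (fun _ => (1 : ℝ)) ω := by
    intro ω
    by_cases h1 : r ^ 2 < (n : ℝ) / N n ω
    · rw [Set.indicator_of_mem (by exact h1)]
      by_cases h2 : N n ω ≤ K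
      · rw [Set.indicator_of_mem (by exact h2)]
        linarith [hg0 (N n ω)]
      · rw [Set.indicator_of_notMem (by exact h2), add_zero]
        refine (hK (N n ω) (not_le.1 h2).le).trans (integral_mono_of_nonneg
          (ae_of_all _ fun _ => minAbsOne_nonneg _) ?_ (ae_of_all _ fun ω' => ?_))
        · exact (integrable_const (1 : ℝ)).mono' (minAbsOne.continuous.measurable.comp
            ((((hZm _).comp hY).const_mul _).div_const _)).aestronglyMeasurable
            (ae_of_all _ fun _ => norm_minAbsOne_le_one _)
        · simp only [minAbsOne_apply]
          refine min_le_min_right _ ?_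
          have h3 : r ≤ √((n : ℝ) / N n ω) := Real.le_sqrt_of_sq_le h1.le
          rw [abs_div, abs_mul, abs_of_pos hr0, abs_of_nonneg (Real.sqrt_nonneg _),
            le_div_iff₀ hr0, mul_comm]
          gcongr
    · rw [Set.indicator_of_notMem (by exact h1)]
      have : 0 ≤ {ω | N n ω ≤ K}.indicator (fun _ => (1 : ℝ)) ω :=
        Set.indicator_nonneg (fun _ _ => zero_le_one) _
      linarith [hg0 (N n ω)]
  have hi1 : Integrable ({ω | N n ω ≤ K}.indicator fun _ => (1 : ℝ)) P :=
    (integrable_const _).indicator hB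
  have hint := integral_mono ((integrable_const (a / 2)).indicator hA) (hgi.add hi1) hpt
  rw [integral_add' hgi hi1, integral_indicator_const _ hA, integral_indicator_const _ hB,
    ← hfub] at hint
  simp only [smul_eq_mul, mul_one] at hint
  have : a / 2 * P.real {ω | r ^ 2 < (n : ℝ) / N n ω} ≤ a / 2 * ε := by linarith
  exact le_of_mul_le_mul_left this (by positivity)

/-- If the Laplace transforms of a sequence of random variables converge to a function that is
right-continuous at `0` with value `1`, then the sequence has tight upper tails. -/
lemma exists_eventually_measureReal_lt_le_of_tendsto_laplace
    {Ω : Type*} [MeasurableSpace Ω] {P : Measure Ω} [IsProbabilityMeasure P]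
    {V : ℕ → Ω → ℝ} (hVm : ∀ n, Measurable (V n)) (hV0 : ∀ n ω, 0 ≤ V n ω) {φ : ℝ → ℝ}
    (hφ : Tendsto φ (𝓝[>] 0) (𝓝 1))
    (h : ∀ s, 0 ≤ s → Tendsto (fun n => ∫ ω, Real.exp (-(s * V n ω)) ∂P) atTop (𝓝 (φ s)))
    {ε : ℝ} (hε : 0 < ε) : ∃ R : ℝ, ∀ᶠ n in atTop, P.real {ω | R < V n ω} ≤ ε := by
  obtain ⟨s, hs, hs0⟩ := ((hφ.eventually_const_lt (show 1 - ε / 2 < 1 by linarith)).and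
    self_mem_nhdsWithin).exists
  have hs0 : 0 < s := hs0
  refine ⟨1 / s, ?_⟩
  filter_upwards [(h s hs0.le).eventually_const_lt hs] with n hn
  have hi : Integrable (fun ω => Real.exp (-(s * V n ω))) P :=
    (integrable_const (1 : ℝ)).mono' (by have := hVm n; fun_prop) (ae_of_all _ fun ω => by
      rw [Real.norm_eq_abs, abs_of_pos (Real.exp_pos _), Real.exp_le_one_iff]
      have := mul_nonneg hs0.le (hV0 n ω)
      linarith)
  have hpos : ∀ ω, 0 ≤ 1 - Real.exp (-(s * V n ω)) := fun ω => by
    have := mul_nonneg hs0.le (hV0 n ω)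
    rw [sub_nonneg, Real.exp_le_one_iff]
    linarith
  have hmk := mul_meas_ge_le_integral_of_nonneg (ae_of_all P hpos) ((integrable_const 1).sub hi)
    (1 / 2)
  rw [integral_sub (integrable_const 1) hi] at hmk
  have hsub : {ω | 1 / s < V n ω} ⊆ {ω | 1 / 2 ≤ 1 - Real.exp (-(s * V n ω))} := by
    intro ω hω
    simp only [Set.mem_ofPred_eq] at hω ⊢
    rw [div_lt_iff₀' hs0] at hω
    have h1 : Real.exp (-(s * V n ω)) ≤ Real.exp (-1) := Real.exp_le_exp.2 (by linarith)
    have h2 := Real.exp_neg_one_lt_half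
    linarith
  have := measureReal_mono (μ := P) hsub
  simp only [integral_const, probReal_univ, smul_eq_mul, mul_one] at hmk
  linarith

lemma isTightMeasureSet_range_of_eventually {μ : ℕ → Measure NNReal} [∀ n, IsFiniteMeasure (μ n)]
    (h : ∀ ε > 0, ∃ R : NNReal, ∀ᶠ n in atTop, (μ n).real {x | R < x} ≤ ε) :
    IsTightMeasureSet (Set.range μ) := by
  rw [isTightMeasureSet_iff_exists_isCompact_measure_compl_le]
  intro ε hε
  obtain ⟨δ, hδ0, hδ⟩ : ∃ δ : ℝ, 0 < δ ∧ ENNReal.ofReal δ ≤ ε := by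
    rcases eq_or_ne ε ⊤ with rfl | hε'
    · exact ⟨1, one_pos, le_top⟩
    · exact ⟨ε.toReal, ENNReal.toReal_pos hε.ne' hε', ENNReal.ofReal_toReal_le⟩
  obtain ⟨R, hR⟩ := h δ hδ0
  obtain ⟨n₀, hn₀⟩ := eventually_atTop.1 hR
  have hsingle : ∀ n, ∃ K, IsCompact K ∧ μ n Kᶜ ≤ ε := fun n => by
    obtain ⟨K, hK, hK'⟩ := isTightMeasureSet_iff_exists_isCompact_measure_compl_le.1
      (isTightMeasureSet_singleton (μ := μ n)) ε hε
    exact ⟨K, hK, hK' _ rfl⟩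
  choose K hK hKε using hsingle
  refine ⟨Set.Icc 0 R ∪ ⋃ n ∈ Finset.range n₀, K n,
    isCompact_Icc.union ((Finset.range n₀).isCompact_biUnion fun n _ => hK n), ?_⟩
  rintro _ ⟨n, rfl⟩
  by_cases hn : n < n₀
  · refine (measure_mono (Set.compl_subset_compl.2 ?_)).trans (hKε n)
    exact (Set.subset_biUnion_of_mem (u := K) (Finset.mem_coe.2 (Finset.mem_range.2 hn))).trans
      Set.subset_union_right
  · calc μ n _ ≤ μ n {x | R < x} := by
          refine measure_mono fun x hx => ?_
          by_contra hxR
          exact hx (Or.inl ⟨zero_le, not_lt.1 hxR⟩)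
      _ = ENNReal.ofReal ((μ n).real {x | R < x}) := (ofReal_measureReal).symm
      _ ≤ ENNReal.ofReal δ := ENNReal.ofReal_le_ofReal (hn₀ n (not_lt.1 hn))
      _ ≤ ε := hδ

lemma expNegInvGlue_of_pos {x : ℝ} (hx : 0 < x) : expNegInvGlue x = Real.exp (-x⁻¹) := by
  simp [expNegInvGlue, not_le.2 hx]

lemma expNegInvGlue_le_one (x : ℝ) : expNegInvGlue x ≤ 1 := by
  rcases le_or_gt x 0 with hx | hx
  · simp [expNegInvGlue.zero_of_nonpos hx]
  · rw [expNegInvGlue_of_pos hx, Real.exp_le_one_iff]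
    have := inv_pos.2 hx
    linarith

lemma norm_expNegInvGlue_le_one (x : ℝ) : ‖expNegInvGlue x‖ ≤ 1 := by
  rw [Real.norm_eq_abs, abs_of_nonneg (expNegInvGlue.nonneg x)]
  exact expNegInvGlue_le_one x

lemma continuous_expNegInvGlue : Continuous expNegInvGlue :=
  (expNegInvGlue.contDiff (n := 0)).continuous

lemma expNegInvGlue_injOn : Set.InjOn expNegInvGlue (Set.Ici 0) := by
  intro x hx y hy h
  rcases (Set.mem_Ici.1 hx).eq_or_lt with rfl | hx'
  · rw [expNegInvGlue.zero] at h
    exact le_antisymm hy (expNegInvGlue.zero_iff_nonpos.1 h.symm)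
  · rcases (Set.mem_Ici.1 hy).eq_or_lt with rfl | hy'
    · rw [expNegInvGlue.zero] at h
      exact le_antisymm (expNegInvGlue.zero_iff_nonpos.1 h) hx
    · rw [expNegInvGlue_of_pos hx', expNegInvGlue_of_pos hy'] at h
      exact inv_injective (neg_injective (Real.exp_injective h))

/-- The bounded continuous function `x ↦ exp (-1 / x)` on the nonnegative reals. -/
noncomputable def expNegInvNNReal : BoundedContinuousFunction NNReal ℝ :=
  BoundedContinuousFunction.ofNormedAddCommGroup (fun x => expNegInvGlue x)
    (continuous_expNegInvGlue.comp NNReal.continuous_coe) 1 fun x => norm_expNegInvGlue_le_one x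

/-- A tight sequence of probability measures on `[0, ∞)` converges weakly as soon as the integrals
of the powers of `exp (-1 / x)` converge. -/
lemma tendsto_of_tendsto_integral_expNegInvNNReal_pow {μ : ℕ → ProbabilityMeasure NNReal}
    {μ₀ : ProbabilityMeasure NNReal}
    (htight : IsTightMeasureSet (Set.range fun n => (μ n : Measure NNReal)))
    (h : ∀ m : ℕ, Tendsto (fun n => ∫ x, expNegInvNNReal x ^ m ∂(μ n : Measure NNReal)) atTop
      (𝓝 (∫ x, expNegInvNNReal x ^ m ∂(μ₀ : Measure NNReal)))) :
    Tendsto μ atTop (𝓝 μ₀) := by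
  let A : StarSubalgebra ℝ (BoundedContinuousFunction NNReal ℝ) :=
    { Algebra.adjoin ℝ {expNegInvNNReal} with
      star_mem' := fun {a} ha => by
        have : star a = a := by ext x; simp
        rwa [this] }
  refine ProbabilityMeasure.tendsto_of_tight_of_separatesPoints ℝ htight (A := A) ?_ ?_
  · intro x y hxy
    refine ⟨expNegInvNNReal, ⟨BoundedContinuousFunction.toContinuousMapStarₐ ℝ expNegInvNNReal,
      ⟨expNegInvNNReal, Algebra.subset_adjoin rfl, rfl⟩, rfl⟩, fun hxy' => hxy ?_⟩
    exact NNReal.coe_injective (expNegInvGlue_injOn x.2 y.2 hxy')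
  · intro g hg
    replace hg : g ∈ Algebra.adjoin ℝ {expNegInvNNReal} := hg
    rw [Algebra.adjoin_singleton_eq_range_aeval] at hg
    obtain ⟨p, rfl⟩ := hg
    change Tendsto (fun n => ∫ x, (Polynomial.aeval expNegInvNNReal p) x ∂(μ n : Measure NNReal))
      atTop (𝓝 (∫ x, (Polynomial.aeval expNegInvNNReal p) x ∂(μ₀ : Measure NNReal)))
    induction p using Polynomial.induction_on' with
    | add p q hp hq =>
      have hadd : ∀ ν : ProbabilityMeasure NNReal,
          ∫ x, (Polynomial.aeval expNegInvNNReal (p + q)) x ∂(ν : Measure NNReal) =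
          ∫ x, (Polynomial.aeval expNegInvNNReal p) x ∂(ν : Measure NNReal) +
          ∫ x, (Polynomial.aeval expNegInvNNReal q) x ∂(ν : Measure NNReal) := fun ν => by
        rw [map_add, ← integral_add (BoundedContinuousFunction.integrable _ _)
          (BoundedContinuousFunction.integrable _ _)]
        rfl
      have := hp.add hq
      simp_rw [← hadd] at this
      exact this
    | monomial m a =>
      have hmon : ∀ ν : ProbabilityMeasure NNReal,
          ∫ x, (Polynomial.aeval expNegInvNNReal (Polynomial.monomial m a)) x
            ∂(ν : Measure NNReal) =
          a * ∫ x, expNegInvNNReal x ^ m ∂(ν : Measure NNReal) := fun ν => by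
        rw [← integral_const_mul]
        congr 1
        ext x
        simp [Polynomial.aeval_monomial, BoundedContinuousFunction.algebraMap_apply]
      have := (h m).const_mul a
      simp_rw [← hmon] at this
      exact this

lemma norm_exp_neg_le_one {x : ℝ} (hx : 0 ≤ x) : ‖Real.exp (-x)‖ ≤ 1 := by
  rw [Real.norm_eq_abs, abs_of_pos (Real.exp_pos _), Real.exp_le_one_iff]
  linarith

lemma tendsto_laplace_atTop {μ : Measure ℝ} [IsProbabilityMeasure μ] (hμ : ∀ᵐ x ∂μ, 0 < x) :
    Tendsto (fun s : ℝ => ∫ x, Real.exp (-(s * x)) ∂μ) atTop (𝓝 0) := by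
  have h := tendsto_integral_filter_of_dominated_convergence (μ := μ) (l := (atTop : Filter ℝ))
    (F := fun s x => Real.exp (-(s * x))) (f := fun _ => (0 : ℝ)) (fun _ => 1)
    (Eventually.of_forall fun s => (by fun_prop))
    ((eventually_ge_atTop 0).mono fun s hs => hμ.mono fun x hx =>
      norm_exp_neg_le_one (mul_nonneg hs hx.le))
    (integrable_const _) (hμ.mono fun x hx =>
      Real.tendsto_exp_neg_atTop_nhds_zero.comp (tendsto_id.atTop_mul_const hx))
  simpa using h

lemma tendsto_laplace_nhdsGT_zero {μ : Measure ℝ} [IsProbabilityMeasure μ]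
    (hμ : ∀ᵐ x ∂μ, 0 < x) :
    Tendsto (fun s : ℝ => ∫ x, Real.exp (-(s * x)) ∂μ) (𝓝[>] 0) (𝓝 1) := by
  have h := tendsto_integral_filter_of_dominated_convergence (μ := μ) (l := 𝓝[>] (0 : ℝ))
    (F := fun s x => Real.exp (-(s * x))) (f := fun _ => (1 : ℝ)) (fun _ => 1)
    (Eventually.of_forall fun s => (by fun_prop))
    (eventually_nhdsWithin_of_forall fun s (hs : 0 < s) => hμ.mono fun x hx =>
      norm_exp_neg_le_one (mul_nonneg hs.le hx.le))
    (integrable_const _) (ae_of_all _ fun x => by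
      have h1 : Continuous fun s : ℝ => Real.exp (-(s * x)) := by fun_prop
      simpa using (h1.tendsto 0).mono_left nhdsWithin_le_nhds)
  simpa using h

/-- Convergence of the Laplace transforms of `n / Nₙ` to the one of a positive random variable
implies convergence in distribution of `Nₙ / n` to its inverse. -/
lemma tendsto_integral_index_div_of_tendsto_laplace
    {Ω : Type*} [MeasurableSpace Ω] {P : Measure Ω} [IsProbabilityMeasure P]
    {N : ℕ → Ω → ℕ} (hNm : ∀ n, Measurable (N n)) (hN1 : ∀ n ω, 1 ≤ N n ω)
    {μ : Measure ℝ} [IsProbabilityMeasure μ] (hμ : ∀ᵐ x ∂μ, 0 < x) {c : ℝ} (hc : 0 < c)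
    (h : ∀ s, 0 ≤ s → Tendsto (fun n : ℕ => ∫ ω, Real.exp (-(s * ((n : ℝ) / N n ω))) ∂P) atTop
      (𝓝 (∫ x, Real.exp (-(s * c * x)) ∂μ))) (f : BoundedContinuousFunction ℝ ℝ) :
    Tendsto (fun n : ℕ => ∫ ω, f ((N n ω : ℝ) / n) ∂P) atTop (𝓝 (∫ x, f (x⁻¹ / c) ∂μ)) := by
  let U : ℕ → Ω → NNReal := fun n ω => (N n ω : NNReal) / n
  have hUm : ∀ n, Measurable (U n) := fun n =>
    (measurable_of_countable fun k : ℕ => (k : NNReal) / n).comp (hNm n)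
  have hUcoe : ∀ n ω, (U n ω : ℝ) = (N n ω : ℝ) / n := fun n ω => by simp [U]
  let W : ℝ → NNReal := fun x => Real.toNNReal (x⁻¹ / c)
  have hWm : Measurable W := by fun_prop
  have hWcoe : ∀ᵐ x ∂μ, (W x : ℝ) = x⁻¹ / c := hμ.mono fun x hx =>
    Real.coe_toNNReal _ (by positivity)
  let μU : ℕ → ProbabilityMeasure NNReal := fun n =>
    ⟨P.map (U n), Measure.isProbabilityMeasure_map (hUm n).aemeasurable⟩
  let μW : ProbabilityMeasure NNReal :=
    ⟨μ.map W, Measure.isProbabilityMeasure_map hWm.aemeasurable⟩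
  have hexp_int : ∀ (n : ℕ) (s : ℝ), 0 ≤ s → Integrable (fun ω => Real.exp (-(s * ((n : ℝ) / N n ω)))) P := by
    intro n s hs
    refine (integrable_const (1 : ℝ)).mono' ((measurable_of_countable fun k : ℕ =>
      Real.exp (-(s * ((n : ℝ) / k)))).comp (hNm n)).aestronglyMeasurable (ae_of_all _ fun ω => ?_)
    exact norm_exp_neg_le_one (by positivity)
  have htight : IsTightMeasureSet (Set.range fun n => (μU n : Measure NNReal)) := by
    refine isTightMeasureSet_range_of_eventually fun ε hε => ?_
    have hlim : Tendsto (fun s : ℝ => ∫ x, Real.exp (-(s * c * x)) ∂μ) atTop (𝓝 0) :=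
      (tendsto_laplace_atTop hμ).comp (tendsto_id.atTop_mul_const hc)
    obtain ⟨s, hs, hs0⟩ := ((hlim.eventually_lt_const (show 0 < ε / 4 by positivity)).and
      (eventually_gt_atTop 0)).exists
    refine ⟨s.toNNReal, ?_⟩
    filter_upwards [(h s hs0.le).eventually_lt_const hs] with n hn
    have hmk := mul_meas_ge_le_integral_of_nonneg
      (ae_of_all P fun ω => (Real.exp_pos (-(s * ((n : ℝ) / N n ω)))).le) (hexp_int n s hs0.le)
      (1 / 4)
    have hsub : U n ⁻¹' {x | s.toNNReal < x} ⊆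
        {ω | 1 / 4 ≤ Real.exp (-(s * ((n : ℝ) / N n ω)))} := by
      intro ω hω
      simp only [Set.mem_preimage, Set.mem_ofPred_eq] at hω ⊢
      have h1 : s < (N n ω : ℝ) / n := by
        rw [← hUcoe, ← Real.coe_toNNReal s hs0.le]
        exact_mod_cast hω
      have h2 : s * ((n : ℝ) / N n ω) ≤ 1 := by
        rw [← inv_div, ← div_eq_mul_inv]
        exact div_le_one_of_le₀ h1.le (by positivity)
      have h3 : Real.exp (-1) ≤ Real.exp (-(s * ((n : ℝ) / N n ω))) :=
        Real.exp_le_exp.2 (by linarith)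
      have h4 := Real.exp_neg_one_gt_d9
      norm_num at h4 ⊢
      linarith
    have hmap : ((μU n : Measure NNReal)).real {x | s.toNNReal < x} =
        P.real (U n ⁻¹' {x | s.toNNReal < x}) :=
      map_measureReal_apply (hUm n) measurableSet_Ioi
    have := measureReal_mono (μ := P) hsub
    rw [hmap]
    linarith
  have hlim : Tendsto μU atTop (𝓝 μW) := by
    refine tendsto_of_tendsto_integral_expNegInvNNReal_pow htight fun m => ?_
    have hW : ∫ x, expNegInvNNReal x ^ m ∂(μW : Measure NNReal) =
        ∫ x, Real.exp (-(m * c * x)) ∂μ := by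
      refine (integral_map hWm.aemeasurable (expNegInvNNReal.continuous.pow
        m).measurable.aestronglyMeasurable).trans (integral_congr_ae ?_)
      filter_upwards [hWcoe, hμ] with x hx hx0
      change expNegInvGlue (W x : ℝ) ^ m = _
      rw [hx, expNegInvGlue_of_pos (by positivity), ← Real.exp_nat_mul]
      congr 1
      field_simp
    rw [hW]
    refine (h m m.cast_nonneg).congr' ?_
    filter_upwards [eventually_gt_atTop 0] with n hn
    symm
    refine (integral_map (hUm n).aemeasurable (expNegInvNNReal.continuous.pow
      m).measurable.aestronglyMeasurable).trans (integral_congr_ae (ae_of_all _ fun ω => ?_))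
    change expNegInvGlue (U n ω : ℝ) ^ m = _
    have h1 : (0 : ℝ) < N n ω := by exact_mod_cast hN1 n ω
    have h2 : (0 : ℝ) < n := by exact_mod_cast hn
    rw [hUcoe, expNegInvGlue_of_pos (by positivity), ← Real.exp_nat_mul]
    congr 1
    rw [inv_div]
    ring
  have hf := ProbabilityMeasure.tendsto_iff_forall_integral_tendsto.1 hlim
    (f.compContinuous ⟨((↑) : NNReal → ℝ), NNReal.continuous_coe⟩)
  have hfm : Measurable fun x : NNReal => f x :=
    f.continuous.measurable.comp NNReal.continuous_coe.measurable
  have hfW : ∫ x, f ((x : NNReal) : ℝ) ∂(μW : Measure NNReal) = ∫ x, f (x⁻¹ / c) ∂μ :=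
    (integral_map hWm.aemeasurable hfm.aestronglyMeasurable).trans
      (integral_congr_ae (hWcoe.mono fun x hx => by simp only [hx]))
  have hfU : ∀ n, ∫ x, f ((x : NNReal) : ℝ) ∂(μU n : Measure NNReal) =
      ∫ ω, f ((N n ω : ℝ) / n) ∂P := fun n =>
    (integral_map (hUm n).aemeasurable hfm.aestronglyMeasurable).trans
      (integral_congr_ae (ae_of_all _ fun ω => by simp only [hUcoe]))
  simp only [BoundedContinuousFunction.compContinuous_apply, ContinuousMap.coe_mk] at hf
  rw [hfW] at hf
  simpa only [hfU] using hf

/-- Convergence in distribution of `Nₙ / n` to the inverse of a positive random variable implies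
convergence of the Laplace transforms of `n / Nₙ`. -/
lemma tendsto_laplace_of_tendsto_integral_index_div
    {Ω : Type*} [MeasurableSpace Ω] {P : Measure Ω} [IsProbabilityMeasure P]
    {N : ℕ → Ω → ℕ} (hN1 : ∀ n ω, 1 ≤ N n ω)
    {μ : Measure ℝ} [IsProbabilityMeasure μ] (hμ : ∀ᵐ x ∂μ, 0 < x) {c : ℝ} (hc : 0 < c)
    (h : ∀ f : BoundedContinuousFunction ℝ ℝ,
      Tendsto (fun n : ℕ => ∫ ω, f ((N n ω : ℝ) / n) ∂P) atTop (𝓝 (∫ x, f (x⁻¹ / c) ∂μ)))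
    {s : ℝ} (hs : 0 ≤ s) :
    Tendsto (fun n : ℕ => ∫ ω, Real.exp (-(s * ((n : ℝ) / N n ω))) ∂P) atTop
      (𝓝 (∫ x, Real.exp (-(s * c * x)) ∂μ)) := by
  rcases hs.eq_or_lt with rfl | hs
  · simp
  let g : BoundedContinuousFunction ℝ ℝ :=
    BoundedContinuousFunction.ofNormedAddCommGroup (fun x => expNegInvGlue (x / s))
      (continuous_expNegInvGlue.comp (continuous_id.div_const s)) 1
      fun x => norm_expNegInvGlue_le_one _
  have hg : ∀ x, 0 < x → g x = Real.exp (-(s * x⁻¹)) := fun x hx => by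
    change expNegInvGlue (x / s) = _
    rw [expNegInvGlue_of_pos (by positivity), inv_div, div_eq_mul_inv]
  have hlim : ∫ x, g (x⁻¹ / c) ∂μ = ∫ x, Real.exp (-(s * c * x)) ∂μ := by
    refine integral_congr_ae (hμ.mono fun x hx => ?_)
    simp only
    rw [hg _ (by positivity), inv_div, div_inv_eq_mul, mul_assoc]
  rw [← hlim]
  refine (h g).congr' ?_
  filter_upwards [eventually_gt_atTop 0] with n hn
  refine integral_congr_ae (ae_of_all _ fun ω => ?_)
  have h1 : (0 : ℝ) < N n ω := by exact_mod_cast hN1 n ω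
  have h2 : (0 : ℝ) < n := by exact_mod_cast hn
  simp only
  rw [hg _ (by positivity), inv_div]

/-- The characteristic function of the randomly indexed and rescaled sequence is asymptotically the
Laplace transform of the random scales. -/
lemma tendsto_integral_exp_index_iff_tendsto_laplace
    {Ω E : Type*} [MeasurableSpace Ω] [MeasurableSpace E] {P : Measure Ω} [IsProbabilityMeasure P]
    {Y : Ω → E} (hY : Measurable Y) {Z : ℕ → E → ℝ} (hZm : ∀ k, Measurable (Z k))
    (hZ : ∀ f : BoundedContinuousFunction ℝ ℝ, Tendsto (fun k => ∫ ω, f (Z k (Y ω)) ∂P) atTop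
      (𝓝 (∫ x, f x ∂(gaussianReal 0 1))))
    {N : ℕ → Ω → ℕ} (hNm : ∀ n, Measurable (N n)) (hYN : ∀ n, IndepFun Y (N n) P)
    (hN : ∀ m : ℕ, Tendsto (fun n => P {ω | N n ω ≤ m}) atTop (𝓝 0))
    (hV : ∀ ε > 0, ∃ R : ℝ, ∀ᶠ n : ℕ in atTop, P.real {ω | R < (n : ℝ) / N n ω} ≤ ε)
    (t a : ℝ) :
    Tendsto (fun n : ℕ => ∫ ω,
      Complex.exp (t * (√((n : ℝ) / N n ω) * Z (N n ω) (Y ω) : ℝ) * Complex.I) ∂P) atTop (𝓝 (a : ℂ))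
    ↔ Tendsto (fun n : ℕ => ∫ ω, Real.exp (-(t ^ 2 / 2 * ((n : ℝ) / N n ω))) ∂P) atTop (𝓝 a) := by
  have hZY : ∀ k, Measurable fun ω => Z k (Y ω) := fun k => (hZm k).comp hY
  let μ : ℕ → ProbabilityMeasure ℝ := fun k =>
    ⟨P.map fun ω => Z k (Y ω), Measure.isProbabilityMeasure_map (hZY k).aemeasurable⟩
  let γ : ProbabilityMeasure ℝ := ⟨gaussianReal 0 1, inferInstance⟩
  have hμ : Tendsto μ atTop (𝓝 γ) := by
    refine ProbabilityMeasure.tendsto_iff_forall_integral_tendsto.2 fun f => ?_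
    refine (hZ f).congr fun k => ?_
    exact (integral_map (hZY k).aemeasurable f.continuous.measurable.aestronglyMeasurable).symm
  have hchar : ∀ n : ℕ, ∫ ω,
      Complex.exp (t * (√((n : ℝ) / N n ω) * Z (N n ω) (Y ω) : ℝ) * Complex.I) ∂P =
      ∫ ω, charFun (μ (N n ω) : Measure ℝ) (t * √((n : ℝ) / N n ω)) ∂P := fun n => by
    rw [integral_comp_index_of_indepFun hY (hNm n) (hYN n)
      (H := fun k y => Complex.exp (t * (√((n : ℝ) / k) * Z k y : ℝ) * Complex.I)) (C := 1)
      (fun k => by have := hZm k; fun_prop)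
      (fun k y => by rw [← Complex.ofReal_mul, Complex.norm_exp_ofReal_mul_I])]
    congr 1
    ext ω
    rw [charFun_apply_real]
    refine Eq.trans ?_ (integral_map (hZY _).aemeasurable
      (by fun_prop : Measurable _).aestronglyMeasurable).symm
    congr 1
    ext ω'
    push_cast
    ring_nf
  have hgauss : ∀ (n : ℕ) (ω : Ω), charFun (γ : Measure ℝ) (t * √((n : ℝ) / N n ω)) =
      (Real.exp (-(t ^ 2 / 2 * ((n : ℝ) / N n ω))) : ℂ) := fun n ω => by
    change charFun (gaussianReal 0 1) _ = _
    rw [charFun_gaussianReal, Complex.ofReal_exp]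
    congr 1
    have h1 : ((√((n : ℝ) / N n ω) : ℝ) : ℂ) ^ 2 = (n : ℂ) / N n ω := by
      rw [← Complex.ofReal_pow, Real.sq_sqrt (by positivity)]
      push_cast
      rfl
    push_cast
    rw [mul_pow, h1]
    ring
  have hdiff := tendsto_integral_charFun_index_sub hμ hNm hN hV t
  have hsub : ∀ n : ℕ, ∫ ω, (charFun (μ (N n ω) : Measure ℝ) (t * √((n : ℝ) / N n ω)) -
      charFun (γ : Measure ℝ) (t * √((n : ℝ) / N n ω))) ∂P =
      ∫ ω, charFun (μ (N n ω) : Measure ℝ) (t * √((n : ℝ) / N n ω)) ∂P -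
      ((∫ ω, Real.exp (-(t ^ 2 / 2 * ((n : ℝ) / N n ω))) ∂P : ℝ) : ℂ) := fun n => by
    rw [← integral_complex_ofReal]
    simp_rw [← hgauss]
    refine integral_sub ((integrable_const (1 : ℝ)).mono' ?_ (ae_of_all _ fun ω =>
      norm_charFun_le_one _)) ((integrable_const (1 : ℝ)).mono' ?_ (ae_of_all _ fun ω =>
      norm_charFun_le_one _))
    · exact ((measurable_of_countable fun k : ℕ =>
        charFun (μ k : Measure ℝ) (t * √((n : ℝ) / k))).comp (hNm n)).aestronglyMeasurable
    · exact ((measurable_of_countable fun k : ℕ =>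
        charFun (γ : Measure ℝ) (t * √((n : ℝ) / k))).comp (hNm n)).aestronglyMeasurable
  simp_rw [hsub] at hdiff
  simp_rw [hchar]
  constructor
  · intro h
    have h1 := h.sub hdiff
    simp only [sub_sub_cancel, sub_zero] at h1
    exact Complex.continuous_re.continuousAt.tendsto.comp h1
  · intro h
    have h1 := hdiff.add ((Complex.continuous_ofReal.tendsto a).comp h)
    simpa using h1

lemma ae_pos_of_laplace_eq {μ : Measure ℝ} [IsProbabilityMeasure μ] {β ν : ℝ} (hβ : 0 < β)
    (hν : 0 < ν) (hμ : μ {x | x < 0} = 0)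
    (h : ∀ s : ℝ, 0 ≤ s → ∫ x, Real.exp (-(s * x)) ∂μ = (1 + s ^ β) ^ (-ν)) :
    ∀ᵐ x ∂μ, 0 < x := by
  have hnn : ∀ᵐ x ∂μ, 0 ≤ x := by
    rw [ae_iff]
    simpa using hμ
  have hlim : Tendsto (fun s : ℝ => (1 + s ^ β) ^ (-ν)) atTop (𝓝 0) :=
    (tendsto_rpow_neg_atTop hν).comp (tendsto_atTop_add_const_left _ 1 (tendsto_rpow_atTop hβ))
  have hle : ∀ s : ℝ, 0 ≤ s → μ.real {0} ≤ (1 + s ^ β) ^ (-ν) := by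
    intro s hs
    rw [← h s hs]
    have h1 : μ.real {0} = ∫ x, ({0} : Set ℝ).indicator (fun _ => (1 : ℝ)) x ∂μ := by
      rw [integral_indicator_const _ (measurableSet_singleton 0)]
      simp
    rw [h1]
    refine integral_mono ((integrable_const _).indicator (measurableSet_singleton 0))
      ((integrable_const (1 : ℝ)).mono' (by fun_prop) (hnn.mono fun x hx =>
        norm_exp_neg_le_one (mul_nonneg hs hx))) fun x => ?_
    by_cases hx : x = 0
    · subst hx
      simp
    · rw [Set.indicator_of_notMem (by simpa using hx)]
      exact (Real.exp_pos _).le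
  have h0 : μ.real {0} = 0 := le_antisymm
    (ge_of_tendsto hlim ((eventually_ge_atTop 0).mono hle)) measureReal_nonneg
  have h0' : μ {0} = 0 := (measureReal_eq_zero_iff).1 h0
  have hne : ∀ᵐ x ∂μ, x ≠ 0 := by
    rw [ae_iff]
    simpa using h0'
  filter_upwards [hnn, hne] with x h1 h2 using lt_of_le_of_ne h1 h2.symm

/-- **Theorem 8 (Korolev–Gorshenin–Zeifman).**
If the statistic `Tₙ` is asymptotically normal, `Nₙ` is independent of the sample and tends to
infinity in probability, then `σ√n (T_{Nₙ} − θ)` converges in distribution to the generalized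
Linnik law with parameters `α` and `ν` if and only if `Nₙ/n` converges in distribution to
`(1/2) M⁻¹`, where `M` has the generalized Mittag-Leffler distribution with parameters
`α/2` and `ν`. -/
theorem randomSize_statistic_generalized_linnik_criterion
    {Ω : Type*} [MeasureSpace Ω] [IsProbabilityMeasure (ℙ : Measure Ω)]
    (α ν : ℝ) (hα : α ∈ Set.Ioc (0 : ℝ) 2) (hν : 0 < ν)
    (X : ℕ → Ω → ℝ) (hXmeas : ∀ i, Measurable (X i))
    (T : (n : ℕ) → (Fin n → ℝ) → ℝ) (hTmeas : ∀ n, Measurable (T n))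
    (σ θ : ℝ) (hσ : 0 < σ)
    -- asymptotic normality of `Tₙ`
    (hTnormal : ∀ f : BoundedContinuousFunction ℝ ℝ,
      Tendsto (fun n : ℕ =>
          ∫ ω, f (σ * Real.sqrt n * (T n (fun i : Fin n => X i ω) - θ)) ∂ℙ)
        atTop (𝓝 (∫ x, f x ∂(gaussianReal 0 1))))
    (N : ℕ → Ω → ℕ) (hNmeas : ∀ n, Measurable (N n))
    (hNpos : ∀ n ω, 1 ≤ N n ω)
    (hNindep : ∀ n, IndepFun (fun ω => (fun i => X i ω)) (N n) ℙ)
    -- `Nₙ → ∞` in probability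
    (hNinfty : ∀ m : ℕ, Tendsto (fun n : ℕ => ℙ {ω | N n ω ≤ m}) atTop (𝓝 0))
    -- the generalized Linnik law with parameters `α` and `ν`
    (μL : Measure ℝ) (hμLprob : IsProbabilityMeasure μL)
    (hμLchar : ∀ t : ℝ,
      ∫ x, Complex.exp (Complex.I * t * x) ∂μL = ((((1 + |t| ^ α) ^ (-ν) : ℝ)) : ℂ))
    -- the generalized Mittag-Leffler law with parameters `α/2` and `ν`
    (μM : Measure ℝ) (hμMprob : IsProbabilityMeasure μM)
    (hμMnn : μM {x | x < 0} = 0)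
    (hμMlap : ∀ s : ℝ, 0 ≤ s →
      ∫ x, Real.exp (-(s * x)) ∂μM = (1 + s ^ (α / 2)) ^ (-ν)) :
    (∀ f : BoundedContinuousFunction ℝ ℝ,
      Tendsto (fun n : ℕ =>
          ∫ ω, f (σ * Real.sqrt n * (T (N n ω) (fun i : Fin (N n ω) => X i ω) - θ)) ∂ℙ)
        atTop (𝓝 (∫ x, f x ∂μL)))
    ↔ (∀ f : BoundedContinuousFunction ℝ ℝ,
      Tendsto (fun n : ℕ => ∫ ω, f ((N n ω : ℝ) / n) ∂ℙ)
        atTop (𝓝 (∫ x, f (x⁻¹ / 2) ∂μM))) := by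
  have hM : ∀ᵐ x ∂μM, 0 < x := ae_pos_of_laplace_eq (half_pos hα.1) hν hμMnn hμMlap
  let Y : Ω → ℕ → ℝ := fun ω i => X i ω
  let Z : ℕ → (ℕ → ℝ) → ℝ := fun k y => σ * √k * (T k (fun i : Fin k => y i) - θ)
  have hY : Measurable Y := measurable_pi_lambda _ hXmeas
  have hZm : ∀ k, Measurable (Z k) := fun k =>
    (((hTmeas k).comp (measurable_pi_lambda _ fun i => measurable_pi_apply _)).sub_const
      θ).const_mul _
  have hS : ∀ (n : ℕ) (ω : Ω), σ * √n * (T (N n ω) (fun i : Fin (N n ω) => X i ω) - θ) =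
      √((n : ℝ) / N n ω) * Z (N n ω) (Y ω) := fun n ω => by
    have h1 : √(N n ω : ℝ) ≠ 0 := by
      have : (0 : ℝ) < N n ω := by exact_mod_cast hNpos n ω
      positivity
    simp only [Z, Y]
    rw [Real.sqrt_div' _ (Nat.cast_nonneg _)]
    field_simp
  have hSm : ∀ n : ℕ, Measurable fun ω => √((n : ℝ) / N n ω) * Z (N n ω) (Y ω) := fun n =>
    (measurable_from_prod_countable_left (f := fun p : (ℕ → ℝ) × ℕ => √((n : ℝ) / p.2) * Z p.2 p.1)
      fun k => (hZm k).const_mul (√((n : ℝ) / k))).comp (hY.prodMk (hNmeas n))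
  simp_rw [hS]
  have hlap : ∀ t : ℝ, ∫ x, Real.exp (-(t ^ 2 / 2 * 2 * x)) ∂μM = (1 + |t| ^ α) ^ (-ν) := fun t => by
    rw [div_mul_cancel₀ _ (two_ne_zero), hμMlap _ (sq_nonneg t), ← sq_abs t,
      ← Real.rpow_natCast_mul (abs_nonneg t)]
    congr 3
    push_cast
    ring
  have hsqrt : ∀ s : ℝ, 0 ≤ s → √(2 * s) ^ 2 / 2 = s := fun s hs => by
    rw [Real.sq_sqrt (by positivity)]
    ring
  have hcharL : ∀ t : ℝ, charFun μL t = (((1 + |t| ^ α) ^ (-ν) : ℝ) : ℂ) := fun t => by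
    rw [charFun_apply_real, ← hμLchar t]
    congr 1
    ext x
    ring_nf
  have key := fun hV => tendsto_integral_exp_index_iff_tendsto_laplace (P := ℙ) hY hZm hTnormal
    hNmeas hNindep hNinfty hV
  let μS : ℕ → ProbabilityMeasure ℝ := fun n =>
    ⟨Measure.map (fun ω => √((n : ℝ) / N n ω) * Z (N n ω) (Y ω)) ℙ,
      Measure.isProbabilityMeasure_map (hSm n).aemeasurable⟩
  have hweak : (∀ f : BoundedContinuousFunction ℝ ℝ,
      Tendsto (fun n : ℕ => ∫ ω, f (√((n : ℝ) / N n ω) * Z (N n ω) (Y ω)) ∂ℙ) atTop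
        (𝓝 (∫ x, f x ∂μL))) ↔ ∀ t : ℝ, Tendsto (fun n : ℕ => ∫ ω,
      Complex.exp (t * (√((n : ℝ) / N n ω) * Z (N n ω) (Y ω) : ℝ) * Complex.I) ∂ℙ) atTop
        (𝓝 (((1 + |t| ^ α) ^ (-ν) : ℝ) : ℂ)) := by
    have h1 := ProbabilityMeasure.tendsto_iff_forall_integral_tendsto (F := atTop) (μs := μS)
      (μ := ⟨μL, hμLprob⟩)
    have h2 := ProbabilityMeasure.tendsto_iff_tendsto_charFun (μ := μS) (μ₀ := ⟨μL, hμLprob⟩)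
    have h3 : ∀ (f : BoundedContinuousFunction ℝ ℝ) (n : ℕ), ∫ x, f x ∂(μS n : Measure ℝ) =
        ∫ ω, f (√((n : ℝ) / N n ω) * Z (N n ω) (Y ω)) ∂ℙ := fun f n =>
      integral_map (hSm n).aemeasurable f.continuous.measurable.aestronglyMeasurable
    have h4 : ∀ (t : ℝ) (n : ℕ), charFun (μS n : Measure ℝ) t = ∫ ω,
        Complex.exp (t * (√((n : ℝ) / N n ω) * Z (N n ω) (Y ω) : ℝ) * Complex.I) ∂ℙ := fun t n => by
      rw [charFun_apply_real]
      exact integral_map (hSm n).aemeasurable (by fun_prop : Measurable _).aestronglyMeasurable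
    simp only [h3, h4, ProbabilityMeasure.coe_mk, hcharL] at h1 h2
    exact h1.symm.trans h2
  constructor
  · intro h f
    have hV := fun (ε : ℝ) (hε : ε > 0) =>
      exists_eventually_measureReal_lt_div_index_le_of_tendsto (P := ℙ) hY hZm hTnormal hNmeas
        hNindep hNinfty h hε
    refine tendsto_integral_index_div_of_tendsto_laplace hNmeas hNpos hM two_pos (fun s hs => ?_) f
    have h1 := (key hV (√(2 * s)) _).1 (hweak.1 h _)
    rwa [← hlap, hsqrt s hs] at h1
  · intro h
    have hB := fun (s : ℝ) (hs : 0 ≤ s) =>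
      tendsto_laplace_of_tendsto_integral_index_div hNpos hM two_pos h hs
    have hφ : Tendsto (fun s : ℝ => ∫ x, Real.exp (-(s * 2 * x)) ∂μM) (𝓝[>] 0) (𝓝 1) := by
      refine (tendsto_laplace_nhdsGT_zero hM).comp (tendsto_nhdsWithin_iff.2 ⟨?_, ?_⟩)
      · have h1 : Continuous fun s : ℝ => s * 2 := by fun_prop
        simpa using (h1.tendsto 0).mono_left nhdsWithin_le_nhds
      · exact eventually_nhdsWithin_of_forall fun s (hs : 0 < s) => mul_pos hs two_pos
    have hV := fun (ε : ℝ) (hε : ε > 0) =>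
      exists_eventually_measureReal_lt_le_of_tendsto_laplace (P := ℙ)
        (V := fun (n : ℕ) ω => (n : ℝ) / N n ω)
        (fun n => (measurable_of_countable fun k : ℕ => (n : ℝ) / k).comp (hNmeas n))
        (fun n ω => by positivity) hφ hB hε
    refine hweak.2 fun t => (key hV t _).2 ?_
    rw [← hlap]
    exact hB _ (by positivity)
end

section
/- Let δ ∈ (0,1] and ν > 0. Let S be a nonnegative random variable with the one-sided strictly stable distribution with characteristic exponent δ (Laplace transform exp(−s^δ)), and let G be a random variable, independent of S, with the generalized gamma distribution with density (δ/Γ(ν))·x^{δν−1}·exp(−x^δ) for x ≥ 0. Then the product S·G has the generalized Mittag-Leffler distribution with parameters δ and ν; that is, E[exp(−s·S·G)] = (1+s^δ)^{−ν} for all s ≥ 0. -/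
open MeasureTheory ProbabilityTheory Real

/-- The Laplace transform of a generalized gamma law in the variable `x ^ δ`. -/
lemma integral_exp_neg_mul_rpow_genGamma {δ ν c : ℝ} (hδ : 0 < δ) (hν : 0 < ν) (hc : 0 ≤ c) :
    ∫ x in Set.Ioi (0 : ℝ),
      (δ / Real.Gamma ν * x ^ (δ * ν - 1) * Real.exp (-(x ^ δ))) * Real.exp (-(c * x ^ δ)) =
    (1 + c) ^ (-ν) := by
  have hint : ∫ x in Set.Ioi (0 : ℝ), x ^ (δ * ν - 1) * Real.exp (-(1 + c) * x ^ δ) =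
      (1 + c) ^ (-ν) * (1 / δ) * Real.Gamma ν := by
    have hδν : 0 < δ * ν := mul_pos hδ hν
    have hexp : (δ * ν - 1 + 1) / δ = ν := by field_simp; ring
    rw [integral_rpow_mul_exp_neg_mul_rpow hδ (by linarith) (by linarith), neg_div, hexp]
  have hfun (x : ℝ) :
      (δ / Real.Gamma ν * x ^ (δ * ν - 1) * Real.exp (-(x ^ δ))) * Real.exp (-(c * x ^ δ)) =
      δ / Real.Gamma ν * (x ^ (δ * ν - 1) * Real.exp (-(1 + c) * x ^ δ)) := by
    rw [mul_assoc, ← Real.exp_add, mul_assoc]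
    ring_nf
  have hΓ := (Real.Gamma_pos_of_pos hν).ne'
  simp_rw [hfun]
  rw [integral_const_mul, hint]
  field_simp

/-- Integration against a measure on `ℝ` with density `f` on `[0, ∞)`. -/
lemma integral_withDensity_ofReal_ite {f : ℝ → ℝ} (hf : Measurable f)
    (hf0 : ∀ x, 0 ≤ x → 0 ≤ f x) (h : ℝ → ℝ) :
    ∫ x, h x ∂(volume.withDensity fun x => ENNReal.ofReal (if 0 ≤ x then f x else 0)) =
    ∫ x in Set.Ioi (0 : ℝ), f x * h x := by
  have hm : Measurable fun x : ℝ => ENNReal.ofReal (if 0 ≤ x then f x else 0) :=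
    (Measurable.ite measurableSet_Ici hf measurable_const).ennreal_ofReal
  rw [integral_withDensity_eq_integral_toReal_smul hm (by simp), ← integral_Ici_eq_integral_Ioi,
    ← integral_indicator measurableSet_Ici]
  congr 1 with x
  by_cases hx : 0 ≤ x
  · simp [hx, hf0 x hx]
  · simp [hx]

/-- A measure on `ℝ` with density supported on `[0, ∞)` is carried by `[0, ∞)`. -/
lemma ae_nonneg_withDensity_ofReal_ite {f : ℝ → ℝ} :
    ∀ᵐ x ∂((volume : Measure ℝ).withDensity fun x =>
      ENNReal.ofReal (if 0 ≤ x then f x else 0)), 0 ≤ x := by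
  have hs : MeasurableSet {x : ℝ | ¬ 0 ≤ x} := measurableSet_Ici.compl
  rw [ae_iff, withDensity_apply _ hs, setLIntegral_congr_fun hs (g := fun _ => 0)]
  · simp
  · intro x hx
    simp [if_neg hx]

/-- Conditioning on the second factor in the Laplace transform of a product of independent
nonnegative random variables. -/
lemma integral_exp_neg_mul_mul_of_indepFun {Ω : Type*} [MeasurableSpace Ω] {μ : Measure Ω}
    [IsProbabilityMeasure μ] {X Y : Ω → ℝ} (hX : Measurable X) (hY : Measurable Y)
    (hX0 : ∀ᵐ ω ∂μ, 0 ≤ X ω) (hY0 : ∀ᵐ ω ∂μ, 0 ≤ Y ω) (hXY : IndepFun X Y μ)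
    {s : ℝ} (hs : 0 ≤ s) :
    ∫ ω, Real.exp (-(s * (X ω * Y ω))) ∂μ =
      ∫ y, ∫ ω, Real.exp (-(s * y * X ω)) ∂μ ∂(μ.map Y) := by
  have hpX : IsProbabilityMeasure (μ.map X) := Measure.isProbabilityMeasure_map hX.aemeasurable
  have hpY : IsProbabilityMeasure (μ.map Y) := Measure.isProbabilityMeasure_map hY.aemeasurable
  have hm : Measurable fun p : ℝ × ℝ => Real.exp (-(s * (p.1 * p.2))) := by fun_prop
  have hprod := (indepFun_iff_map_prod_eq_prod_map_map hX.aemeasurable hY.aemeasurable).1 hXY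
  have hi : Integrable (fun p : ℝ × ℝ => Real.exp (-(s * (p.1 * p.2))))
      ((μ.map X).prod (μ.map Y)) := by
    rw [← hprod, integrable_map_measure hm.aestronglyMeasurable (hX.prodMk hY).aemeasurable]
    refine Integrable.of_bound (hm.comp (hX.prodMk hY)).aestronglyMeasurable 1 ?_
    filter_upwards [hX0, hY0] with ω hx hy
    have : 0 ≤ s * (X ω * Y ω) := by positivity
    simpa using this
  calc ∫ ω, Real.exp (-(s * (X ω * Y ω))) ∂μ
      = ∫ p, Real.exp (-(s * (p.1 * p.2))) ∂((μ.map X).prod (μ.map Y)) := by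
        rw [← hprod, integral_map (hX.prodMk hY).aemeasurable hm.aestronglyMeasurable]
    _ = ∫ y, ∫ x, Real.exp (-(s * (x * y))) ∂(μ.map X) ∂(μ.map Y) := integral_prod_symm _ hi
    _ = _ := by
        congr 1 with y
        rw [integral_map hX.aemeasurable (by fun_prop)]
        congr 1 with ω
        ring_nf

/-- **Relation (16) (Korolev–Gorshenin–Zeifman).**
If `δ ∈ (0,1]`, `ν > 0`, `S` is one-sided strictly stable with exponent `δ`, and `G` has the
generalized gamma distribution with density `(δ/Γ(ν)) x^(δν-1) exp(-x^δ)` on `[0,∞)`,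
with `S`, `G` independent, then `S · G` has the generalized Mittag-Leffler distribution with
parameters `δ` and `ν`. -/
theorem generalized_mittagLeffler_as_stable_genGamma_product
    {Ω : Type*} [MeasureSpace Ω] [IsProbabilityMeasure (ℙ : Measure Ω)]
    (δ ν : ℝ) (hδ : δ ∈ Set.Ioc (0 : ℝ) 1) (hν : 0 < ν)
    (S G : Ω → ℝ) (hS : Measurable S) (hG : Measurable G)
    (hSnn : ∀ᵐ ω ∂ℙ, 0 ≤ S ω)
    (hSlap : ∀ s : ℝ, 0 ≤ s →
      ∫ ω, Real.exp (-(s * S ω)) ∂ℙ = Real.exp (-(s ^ δ)))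
    (hGlaw : Measure.map G ℙ = volume.withDensity (fun x =>
      ENNReal.ofReal (if 0 ≤ x then
        (δ / Real.Gamma ν) * x ^ (δ * ν - 1) * Real.exp (-(x ^ δ)) else 0)))
    (hindep : IndepFun S G ℙ) :
    ∀ s : ℝ, 0 ≤ s →
      ∫ ω, Real.exp (-(s * (S ω * G ω))) ∂ℙ = (1 + s ^ δ) ^ (-ν) := by
  intro s hs
  have hδ0 := hδ.1
  have hΓ := Real.Gamma_pos_of_pos hν
  have hlaw0 : ∀ᵐ x ∂(Measure.map G ℙ), 0 ≤ x := by
    rw [hGlaw]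
    exact ae_nonneg_withDensity_ofReal_ite
  have hG0 : ∀ᵐ ω ∂ℙ, 0 ≤ G ω := ae_of_ae_map hG.aemeasurable hlaw0
  have hcond : ∀ᵐ x ∂(Measure.map G ℙ),
      ∫ ω, Real.exp (-(s * x * S ω)) ∂ℙ = Real.exp (-(s ^ δ * x ^ δ)) := by
    filter_upwards [hlaw0] with x hx
    rw [hSlap _ (mul_nonneg hs hx), Real.mul_rpow hs hx]
  rw [integral_exp_neg_mul_mul_of_indepFun hS hG hSnn hG0 hindep hs, integral_congr_ae hcond,
    hGlaw, integral_withDensity_ofReal_ite (by fun_prop) (fun x hx => by positivity),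
    integral_exp_neg_mul_rpow_genGamma hδ0 hν (Real.rpow_nonneg hs δ)]
end

section
/- Let δ ∈ (0,1]. Let S be a nonnegative random variable with the one-sided strictly stable distribution with characteristic exponent δ (Laplace transform exp(−s^δ)), and let W be a random variable, independent of S, with the Weibull distribution with shape parameter δ (P(W < x) = 1 − exp(−x^δ) for x ≥ 0). Then the product S·W has the Mittag-Leffler distribution with parameter δ; that is, E[exp(−s·S·W)] = (1+s^δ)^{−1} for all s ≥ 0. -/
open MeasureTheory ProbabilityTheory Real

/-- The Laplace transform of the exponential distribution. -/
theorem integral_exp_neg_mul_expMeasure {r a : ℝ} (hr : 0 < r) (ha : 0 ≤ a) :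
    ∫ x, rexp (-(a * x)) ∂(expMeasure r) = r / (r + a) := by
  have hpdf : ∀ x, (exponentialPDF r x).toReal • rexp (-(a * x)) =
      (Set.Ici (0 : ℝ)).indicator (fun x ↦ r * rexp (-(r + a) * x)) x := by
    intro x
    by_cases hx : 0 ≤ x
    · rw [exponentialPDF_of_nonneg hx, ENNReal.toReal_ofReal (by positivity),
        Set.indicator_of_mem (Set.mem_Ici.2 hx), smul_eq_mul, mul_assoc, ← Real.exp_add]
      ring_nf
    · rw [exponentialPDF_of_neg (not_le.1 hx), Set.indicator_of_notMem (by simpa using hx)]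
      simp
  change ∫ x, rexp (-(a * x)) ∂(volume.withDensity (exponentialPDF r)) = _
  rw [integral_withDensity_eq_integral_toReal_smul (f := exponentialPDF r)
    (measurable_exponentialPDFReal r).ennreal_ofReal
    (Filter.Eventually.of_forall fun _ ↦ ENNReal.ofReal_lt_top)]
  simp_rw [hpdf]
  rw [integral_indicator measurableSet_Ici, integral_Ici_eq_integral_Ioi, integral_const_mul,
    integral_exp_mul_Ioi (by linarith)]
  have : r + a ≠ 0 := by positivity
  simp only [mul_zero, Real.exp_zero, neg_div_neg_eq]
  ring

theorem expMeasure_Iio {r : ℝ} (hr : 0 < r) {x : ℝ} (hx : 0 ≤ x) :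
    expMeasure r (Set.Iio x) = ENNReal.ofReal (1 - rexp (-(r * x))) := by
  have := isProbabilityMeasure_expMeasure hr
  have : NullSingletonClass (expMeasure r) := by unfold expMeasure gammaMeasure; infer_instance
  rw [measure_congr (Iio_ae_eq_Iic (μ := expMeasure r)), ← ofReal_cdf, cdf_expMeasure_eq hr,
    if_pos hx]

/-- If `W` has the Weibull distribution with shape parameter `δ`, then `W ^ δ` has the standard
exponential distribution. -/
theorem map_rpow_eq_expMeasure_of_weibull {Ω : Type*} [MeasurableSpace Ω] {μ : Measure Ω}
    [IsProbabilityMeasure μ] {δ : ℝ} (hδ : 0 < δ) {W : Ω → ℝ} (hW : Measurable W)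
    (hWnn : ∀ᵐ ω ∂μ, 0 ≤ W ω)
    (hWcdf : ∀ x : ℝ, 0 ≤ x → μ {ω | W ω < x} = ENNReal.ofReal (1 - rexp (-(x ^ δ)))) :
    μ.map (fun ω ↦ W ω ^ δ) = expMeasure 1 := by
  have hV : Measurable (fun ω ↦ W ω ^ δ) := hW.pow_const δ
  have := isProbabilityMeasure_expMeasure one_pos
  have := Measure.isProbabilityMeasure_map (μ := μ) hV.aemeasurable
  have key : ∀ a : ℝ, 0 ≤ a → μ.map (fun ω ↦ W ω ^ δ) (Set.Iio a) = expMeasure 1 (Set.Iio a) := by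
    intro a ha
    have hset : (fun ω ↦ W ω ^ δ) ⁻¹' Set.Iio a =ᵐ[μ] {ω | W ω < a ^ δ⁻¹} := by
      filter_upwards [hWnn] with ω hω
      exact propext (Real.lt_rpow_inv_iff_of_pos hω ha hδ).symm
    rw [Measure.map_apply hV measurableSet_Iio, measure_congr hset, hWcdf _ (by positivity),
      expMeasure_Iio one_pos ha, Real.rpow_inv_rpow ha hδ.ne', one_mul]
  refine Measure.ext_of_Ici _ _ fun a ↦ ?_
  rw [← Set.compl_Iio, prob_compl_eq_one_sub measurableSet_Iio,
    prob_compl_eq_one_sub measurableSet_Iio]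
  congr 1
  rcases le_total 0 a with ha | ha
  · exact key a ha
  · have h0 : expMeasure 1 (Set.Iio 0) = 0 := by simp [expMeasure_Iio one_pos le_rfl]
    rw [measure_mono_null (Set.Iio_subset_Iio ha) h0,
      measure_mono_null (Set.Iio_subset_Iio ha) ((key 0 le_rfl).trans h0)]

open MeasureTheory ProbabilityTheory Real

/-- **Lemma 5 (Korolev–Gorshenin–Zeifman).**
If `δ ∈ (0,1]`, `S` is one-sided strictly stable with exponent `δ` and `W` has the Weibull
distribution with shape parameter `δ`, independent of `S`, then `S · W` has the
Mittag-Leffler distribution with parameter `δ`. -/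
theorem mittagLeffler_as_stable_weibull_product
    {Ω : Type*} [MeasureSpace Ω] [IsProbabilityMeasure (ℙ : Measure Ω)]
    (δ : ℝ) (hδ : δ ∈ Set.Ioc (0 : ℝ) 1)
    (S W : Ω → ℝ) (hS : Measurable S) (hW : Measurable W)
    (hSnn : ∀ᵐ ω ∂ℙ, 0 ≤ S ω)
    (hSlap : ∀ s : ℝ, 0 ≤ s →
      ∫ ω, Real.exp (-(s * S ω)) ∂ℙ = Real.exp (-(s ^ δ)))
    (hWnn : ∀ᵐ ω ∂ℙ, 0 ≤ W ω)
    (hWcdf : ∀ x : ℝ, 0 ≤ x →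
      ℙ {ω | W ω < x} = ENNReal.ofReal (1 - Real.exp (-(x ^ δ))))
    (hindep : IndepFun S W ℙ) :
    ∀ s : ℝ, 0 ≤ s →
      ∫ ω, Real.exp (-(s * (S ω * W ω))) ∂ℙ = (1 + s ^ δ)⁻¹ := by
  intro s hs
  have hSW : Measurable fun ω ↦ (S ω, W ω) := hS.prodMk hW
  have hF : Measurable fun p : ℝ × ℝ ↦ rexp (-(s * (p.1 * p.2))) := by fun_prop
  have hint : Integrable (fun p : ℝ × ℝ ↦ rexp (-(s * (p.1 * p.2))))
      ((ℙ : Measure Ω).map fun ω ↦ (S ω, W ω)) := by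
    rw [integrable_map_measure hF.aestronglyMeasurable hSW.aemeasurable]
    refine Integrable.of_bound (hF.comp hSW).aestronglyMeasurable 1 ?_
    filter_upwards [hSnn, hWnn] with ω h₁ h₂
    simp only [Function.comp_apply, Real.norm_eq_abs, Real.abs_exp, Real.exp_le_one_iff]
    exact neg_nonpos.2 (by positivity)
  have hprod := (indepFun_iff_map_prod_eq_prod_map_map hS.aemeasurable hW.aemeasurable).1 hindep
  have := Measure.isProbabilityMeasure_map (μ := (ℙ : Measure Ω)) hS.aemeasurable
  have := Measure.isProbabilityMeasure_map (μ := (ℙ : Measure Ω)) hW.aemeasurable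
  calc ∫ ω, rexp (-(s * (S ω * W ω))) ∂ℙ
      = ∫ p, rexp (-(s * (p.1 * p.2))) ∂((ℙ : Measure Ω).map fun ω ↦ (S ω, W ω)) :=
        (integral_map hSW.aemeasurable hF.aestronglyMeasurable).symm
    _ = ∫ w, ∫ x, rexp (-(s * (x * w))) ∂((ℙ : Measure Ω).map S) ∂((ℙ : Measure Ω).map W) := by
        rw [hprod] at hint ⊢
        exact integral_prod_symm _ hint
    _ = ∫ ω, ∫ x, rexp (-(s * (x * W ω))) ∂((ℙ : Measure Ω).map S) ∂ℙ :=
        integral_map hW.aemeasurable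
          hF.stronglyMeasurable.integral_prod_left'.aestronglyMeasurable
    _ = ∫ ω, rexp (-(s ^ δ * W ω ^ δ)) ∂ℙ := by
        refine integral_congr_ae ?_
        filter_upwards [hWnn] with ω hω
        rw [integral_map hS.aemeasurable (by fun_prop), ← Real.mul_rpow hs hω,
          ← hSlap _ (mul_nonneg hs hω)]
        congr with ω'
        ring_nf
    _ = ∫ v, rexp (-(s ^ δ * v)) ∂(expMeasure 1) := by
        rw [← map_rpow_eq_expMeasure_of_weibull hδ.1 hW hWnn hWcdf,
          integral_map (hW.pow_const δ).aemeasurable (by fun_prop)]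
    _ = (1 + s ^ δ)⁻¹ := by
        rw [integral_exp_neg_mul_expMeasure one_pos (by positivity), one_div]
end

section
/- Let α ∈ (0,2]. Let S be a random variable with the symmetric strictly stable distribution with characteristic exponent α (characteristic function exp(−|t|^α)), and let W be a random variable, independent of S, with the standard exponential distribution (P(W < x) = 1 − e^{−x} for x ≥ 0). Then the random variable S·W^{1/α} has the Linnik distribution with parameter α; that is, E[exp(it·S·W^{1/α})] = (1+|t|^α)^{−1} for all t ∈ ℝ. -/
open MeasureTheory ProbabilityTheory Real

/-- A probability measure on `ℝ` that is carried by `[0, ∞)` and gives `(-∞, x)` the mass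
`1 - exp (-x)` for every `x ≥ 0` is the standard exponential distribution. -/
lemma eq_expMeasure_one_of_Iio {ν : Measure ℝ} [IsProbabilityMeasure ν]
    (hnn : ∀ᵐ x ∂ν, 0 ≤ x)
    (hcdf : ∀ x : ℝ, 0 ≤ x → ν (Set.Iio x) = ENNReal.ofReal (1 - Real.exp (-x))) :
    ν = expMeasure 1 := by
  have : IsProbabilityMeasure (expMeasure 1) := isProbabilityMeasure_expMeasure one_pos
  have : NullSingletonClass (expMeasure 1) := nullSingletonClass_withDensity _
  have hIio (x : ℝ) : ν (Set.Iio x) = expMeasure 1 (Set.Iio x) := by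
    rw [measure_congr (Iio_ae_eq_Iic (μ := expMeasure 1)), ← ofReal_cdf,
      cdf_expMeasure_eq one_pos]
    split_ifs with hx
    · simpa using hcdf x hx
    · rw [ENNReal.ofReal_zero]
      refine measure_mono_null (fun y hy ↦ ?_) hnn
      exact not_le.mpr (lt_trans hy (not_le.mp hx))
  refine Measure.ext_of_Ici _ _ fun x ↦ ?_
  rw [← Set.compl_Iio, prob_compl_eq_one_sub measurableSet_Iio,
    prob_compl_eq_one_sub measurableSet_Iio, hIio]

/-- The Laplace transform of the standard exponential distribution. -/
lemma integral_exp_neg_mul_expMeasure_one {c : ℝ} (hc : 0 ≤ c) :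
    ∫ x, Real.exp (-(c * x)) ∂expMeasure 1 = (1 + c)⁻¹ := by
  have hdens (x : ℝ) : (gammaPDF 1 1 x).toReal • Real.exp (-(c * x))
      = (Set.Ici (0 : ℝ)).indicator (fun x ↦ Real.exp (-(1 + c) * x)) x := by
    rw [gammaPDF, ENNReal.toReal_ofReal (gammaPDFReal_nonneg one_pos one_pos x)]
    by_cases hx : 0 ≤ x
    · simp [gammaPDFReal, hx, ← Real.exp_add]
      ring
    · simp [gammaPDFReal, hx]
  have hmeas : Measurable (gammaPDF 1 1) := (measurable_gammaPDFReal 1 1).ennreal_ofReal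
  rw [expMeasure, gammaMeasure, integral_withDensity_eq_integral_toReal_smul hmeas
    (ae_of_all _ fun _ ↦ ENNReal.ofReal_lt_top)]
  simp_rw [hdens]
  rw [integral_indicator measurableSet_Ici, integral_Ici_eq_integral_Ioi,
    integral_exp_mul_Ioi (by linarith), mul_zero, Real.exp_zero, neg_div_neg_eq, one_div]

/-- **Lemma 8 (Devroye; Korolev–Gorshenin–Zeifman).**
If `α ∈ (0,2]`, `S` is symmetric strictly stable with exponent `α` and `W` has the standard
exponential distribution, independent of `S`, then `S · W^(1/α)` has the Linnik distribution
with parameter `α`. -/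
theorem linnik_as_stable_exponential_mixture
    {Ω : Type*} [MeasureSpace Ω] [IsProbabilityMeasure (ℙ : Measure Ω)]
    (α : ℝ) (hα : α ∈ Set.Ioc (0 : ℝ) 2)
    (S W : Ω → ℝ) (hS : Measurable S) (hW : Measurable W)
    (hSchar : ∀ t : ℝ,
      ∫ ω, Complex.exp (Complex.I * t * S ω) ∂ℙ = ((Real.exp (-(|t| ^ α)) : ℝ) : ℂ))
    (hWnn : ∀ᵐ ω ∂ℙ, 0 ≤ W ω)
    (hWcdf : ∀ x : ℝ, 0 ≤ x →
      ℙ {ω | W ω < x} = ENNReal.ofReal (1 - Real.exp (-x)))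
    (hindep : IndepFun S W ℙ) :
    ∀ t : ℝ,
      ∫ ω, Complex.exp (Complex.I * t * ((S ω * W ω ^ (1 / α) : ℝ) : ℂ)) ∂ℙ
        = ((((1 + |t| ^ α)⁻¹ : ℝ)) : ℂ) := by
  intro t
  have hα0 : 0 < α := hα.1
  have := Measure.isProbabilityMeasure_map (μ := (ℙ : Measure Ω)) hW.aemeasurable
  have := Measure.isProbabilityMeasure_map (μ := (ℙ : Measure Ω)) hS.aemeasurable
  have hlawW : Measure.map W ℙ = expMeasure 1 := by
    refine eq_expMeasure_one_of_Iio ((ae_map_iff hW.aemeasurable measurableSet_Ici).mpr hWnn) ?_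
    intro x hx
    rw [Measure.map_apply hW measurableSet_Iio]
    exact hWcdf x hx
  let F : ℝ × ℝ → ℂ := fun p ↦ Complex.exp (Complex.I * t * ((p.1 * p.2 ^ (1 / α) : ℝ) : ℂ))
  have hF : Measurable F := by fun_prop
  have hFint : Integrable F ((Measure.map S ℙ).prod (Measure.map W ℙ)) := by
    refine Integrable.of_bound hF.aestronglyMeasurable 1 (ae_of_all _ fun p ↦ ?_)
    simp [F, Complex.norm_exp]
  have hinner : ∀ᵐ w ∂Measure.map W ℙ,
      ∫ s, F (s, w) ∂Measure.map S ℙ = ((Real.exp (-(|t| ^ α * w)) : ℝ) : ℂ) := by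
    rw [ae_map_iff hW.aemeasurable]
    · filter_upwards [hWnn] with ω hω
      have hFω : Measurable fun s ↦ F (s, W ω) := hF.comp measurable_prodMk_right
      rw [integral_map hS.aemeasurable hFω.aestronglyMeasurable]
      have hpow : |t * W ω ^ (1 / α)| ^ α = |t| ^ α * W ω := by
        rw [abs_mul, mul_rpow (abs_nonneg _) (abs_nonneg _), abs_of_nonneg (rpow_nonneg hω _),
          ← rpow_mul hω, one_div_mul_cancel hα0.ne', rpow_one]
      rw [← hpow, ← hSchar]
      refine integral_congr_ae (ae_of_all _ fun ω' ↦ ?_)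
      simp only [F]
      push_cast
      ring_nf
    · exact measurableSet_eq_fun hF.stronglyMeasurable.integral_prod_left'.measurable (by fun_prop)
  calc ∫ ω, F (S ω, W ω) ∂ℙ
      = ∫ p, F p ∂((Measure.map S ℙ).prod (Measure.map W ℙ)) := by
        rw [← hindep.map_prod_eq_prod_map_map hS.aemeasurable hW.aemeasurable,
          integral_map (hS.prodMk hW).aemeasurable hF.aestronglyMeasurable]
    _ = ∫ w, ((Real.exp (-(|t| ^ α * w)) : ℝ) : ℂ) ∂Measure.map W ℙ := by
        rw [integral_prod_symm F hFint, integral_congr_ae hinner]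
    _ = (((1 + |t| ^ α)⁻¹ : ℝ) : ℂ) := by
        rw [integral_complex_ofReal, hlawW,
          integral_exp_neg_mul_expMeasure_one (rpow_nonneg (abs_nonneg t) α)]
end

section
/- Let α ∈ (0,2]. Let M be a nonnegative random variable with the Mittag-Leffler distribution with parameter α/2 (Laplace transform (1+s^{α/2})^{−1}), and let X be a standard normal random variable independent of M. Then the random variable X·√(2M) has the Linnik distribution with parameter α; that is, E[exp(it·X√(2M))] = (1+|t|^α)^{−1} for all t ∈ ℝ. -/
open MeasureTheory ProbabilityTheory Real

/-- The characteristic function of a normal variance mixture `X · √(2M)` is the Laplace transform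
of `M` at the square of the argument. -/
theorem integral_cexp_mul_sqrt_two_mul_of_indepFun
    {Ω : Type*} [MeasurableSpace Ω] {μ : Measure Ω} [IsProbabilityMeasure μ]
    {X M : Ω → ℝ} (hX : Measurable X) (hM : Measurable M)
    (hXlaw : μ.map X = gaussianReal 0 1) (hMnn : ∀ᵐ ω ∂μ, 0 ≤ M ω)
    (hindep : IndepFun X M μ) (t : ℝ) :
    ∫ ω, Complex.exp (Complex.I * t * ((X ω * √(2 * M ω) : ℝ) : ℂ)) ∂μ
      = ((∫ ω, Real.exp (-(t ^ 2 * M ω)) ∂μ : ℝ) : ℂ) := by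
  set f : ℝ × ℝ → ℂ := fun p ↦ Complex.exp (Complex.I * t * ((p.1 * √(2 * p.2) : ℝ) : ℂ)) with hf
  have hfm : Measurable f := by fun_prop
  have : IsProbabilityMeasure (μ.map M) := Measure.isProbabilityMeasure_map hM.aemeasurable
  have hfi : Integrable f ((gaussianReal 0 1).prod (μ.map M)) := by
    refine Integrable.of_bound hfm.aestronglyMeasurable 1 (ae_of_all _ fun p ↦ ?_)
    simp [hf, Complex.norm_exp]
  have hinner (m : ℝ) :
      ∫ x, f (x, m) ∂(gaussianReal 0 1) = Complex.exp (-((t * √(2 * m)) ^ 2 / 2 : ℝ)) := by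
    have h := charFun_gaussianReal (μ := 0) (v := 1) (t * √(2 * m))
    rw [charFun_apply_real] at h
    convert h using 1
    · congr! 2 with x
      simp only [hf]
      push_cast
      ring_nf
    · congr 1
      push_cast
      ring
  have hmap := (indepFun_iff_map_prod_eq_prod_map_map hX.aemeasurable hM.aemeasurable).1 hindep
  calc ∫ ω, Complex.exp (Complex.I * t * ((X ω * √(2 * M ω) : ℝ) : ℂ)) ∂μ
      = ∫ p, f p ∂(μ.map fun ω ↦ (X ω, M ω)) :=
        (integral_map (hX.prodMk hM).aemeasurable hfm.aestronglyMeasurable).symm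
    _ = ∫ m, ∫ x, f (x, m) ∂(gaussianReal 0 1) ∂(μ.map M) := by
        rw [hmap, hXlaw, integral_prod_symm f hfi]
    _ = ∫ ω, Complex.exp (-((t * √(2 * M ω)) ^ 2 / 2 : ℝ)) ∂μ := by
        simp_rw [hinner]
        exact integral_map hM.aemeasurable (by fun_prop)
    _ = ∫ ω, ((Real.exp (-(t ^ 2 * M ω)) : ℝ) : ℂ) ∂μ := by
        refine integral_congr_ae (hMnn.mono fun ω hω ↦ ?_)
        have h : (t * √(2 * M ω)) ^ 2 / 2 = t ^ 2 * M ω := by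
          rw [mul_pow, Real.sq_sqrt (by positivity)]
          ring
        simp only [h]
        push_cast
        rfl
    _ = _ := integral_ofReal

/-- **Corollary 4 (Korolev–Zeifman).**
If `α ∈ (0,2]`, `M` has the Mittag-Leffler distribution with parameter `α/2` and `X` is
standard normal, independent of `M`, then `X · √(2M)` has the Linnik distribution with
parameter `α`. -/
theorem linnik_as_normal_mittagLeffler_mixture
    {Ω : Type*} [MeasureSpace Ω] [IsProbabilityMeasure (ℙ : Measure Ω)]
    (α : ℝ) (hα : α ∈ Set.Ioc (0 : ℝ) 2)
    (X M : Ω → ℝ) (hX : Measurable X) (hM : Measurable M)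
    (hXlaw : Measure.map X ℙ = gaussianReal 0 1)
    (hMnn : ∀ᵐ ω ∂ℙ, 0 ≤ M ω)
    (hMlap : ∀ s : ℝ, 0 ≤ s →
      ∫ ω, Real.exp (-(s * M ω)) ∂ℙ = (1 + s ^ (α / 2))⁻¹)
    (hindep : IndepFun X M ℙ) :
    ∀ t : ℝ,
      ∫ ω, Complex.exp (Complex.I * t * ((X ω * Real.sqrt (2 * M ω) : ℝ) : ℂ)) ∂ℙ
        = ((((1 + |t| ^ α)⁻¹ : ℝ)) : ℂ) := by
  intro t
  rw [integral_cexp_mul_sqrt_two_mul_of_indepFun hX hM hXlaw hMnn hindep t,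
    hMlap (t ^ 2) (sq_nonneg t), ← sq_abs, ← Real.rpow_natCast_mul (abs_nonneg t)]
  congr 4
  push_cast
  ring
end
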